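/- Let r := √2 − 1, L' := 4·√(2r/(1 + 2r)) and ε := 1/445. Every FM-tetrahedron T with radii r_A = r_B = r_C = 1 and r_D = r, with edge lengths dist(A,C), dist(B,C) ∈ [2, 2 + ε], dist(A,D), dist(B,D), dist(C,D) ∈ [1 + r, 1 + r + ε] and dist(A,B) ∈ [L' − ε, L' + ε], satisfies δ(T) ≤ δ(T₀), where T₀ is any weighted tetrahedron with radii (1,1,1,r) and edge lengths dist(A,B) = L', dist(A,C) = dist(B,C) = 2, dist(A,D) = dist(B,D) = dist(C,D) = 1 + r (the densest tetrahedron of type 111r). -/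

import Mathlib

open MeasureTheory Metric

noncomputable def tetra (A B C D : EuclideanSpace ℝ (Fin 3)) :
    Set (EuclideanSpace ℝ (Fin 3)) :=
  convexHull ℝ {A, B, C, D}

noncomputable def density (A B C D : EuclideanSpace ℝ (Fin 3)) (rA rB rC rD : ℝ) : ℝ :=
  (volume (tetra A B C D ∩
    (closedBall A rA ∪ closedBall B rB ∪ closedBall C rC ∪ closedBall D rD))).toReal /
  (volume (tetra A B C D)).toReal


-- Part Wedge


noncomputable def radK (ρ : ℝ) : ENNReal :=
  ∫⁻ t in Set.Ioi (0:ℝ), ENNReal.ofReal t * volume {z : ℝ | t ^ 2 + z ^ 2 ≤ ρ ^ 2}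

lemma vol_angular (ρ : ℝ) (A : Set (ℝ × ℝ)) (hA : MeasurableSet A) (J : Set ℝ)
    (hJ : MeasurableSet J)
    (h : ∀ t φ : ℝ, 0 < t → φ ∈ Set.Ioo (-Real.pi) Real.pi →
      ((t * Real.cos φ, t * Real.sin φ) ∈ A ↔ φ ∈ J)) :
    volume {q : (ℝ × ℝ) × ℝ | q.1.1 ^ 2 + q.1.2 ^ 2 + q.2 ^ 2 ≤ ρ ^ 2 ∧ q.1 ∈ A} =
      radK ρ * volume (J ∩ Set.Ioo (-Real.pi) Real.pi) := by
  have hm1 : MeasurableSet {q : (ℝ × ℝ) × ℝ | q.1.1 ^ 2 + q.1.2 ^ 2 + q.2 ^ 2 ≤ ρ ^ 2} :=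
    measurableSet_le (by fun_prop) (by fun_prop)
  have hm : MeasurableSet {q : (ℝ × ℝ) × ℝ | q.1.1 ^ 2 + q.1.2 ^ 2 + q.2 ^ 2 ≤ ρ ^ 2 ∧ q.1 ∈ A} :=
    hm1.inter (measurable_fst hA)
  have hmk : Measurable (fun t : ℝ => volume {z : ℝ | t ^ 2 + z ^ 2 ≤ ρ ^ 2}) := by
    have : MeasurableSet {q : ℝ × ℝ | q.1 ^ 2 + q.2 ^ 2 ≤ ρ ^ 2} :=
      measurableSet_le (by fun_prop) (by fun_prop)
    exact measurable_measure_prodMk_left this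
  rw [Measure.volume_eq_prod, Measure.prod_apply hm, ← lintegral_comp_polarCoord_symm]
  have hprod : (volume : Measure (ℝ × ℝ)).restrict polarCoord.target =
      (volume.restrict (Set.Ioi (0:ℝ))).prod (volume.restrict (Set.Ioo (-Real.pi) Real.pi)) := by
    rw [Measure.prod_restrict]; rfl
  have e1 : ∫⁻ p in polarCoord.target, ENNReal.ofReal p.1 •
        volume (Prod.mk (polarCoord.symm p) ⁻¹'
          {q : (ℝ × ℝ) × ℝ | q.1.1 ^ 2 + q.1.2 ^ 2 + q.2 ^ 2 ≤ ρ ^ 2 ∧ q.1 ∈ A}) =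
      ∫⁻ p in polarCoord.target, (ENNReal.ofReal p.1 * volume {z : ℝ | p.1 ^ 2 + z ^ 2 ≤ ρ ^ 2}) *
        J.indicator 1 p.2 := by
    refine setLIntegral_congr_fun polarCoord.open_target.measurableSet ?_
    rintro ⟨t, φ⟩ ⟨ht, hφ⟩
    have ht' : 0 < t := ht
    have hφ' : φ ∈ Set.Ioo (-Real.pi) Real.pi := hφ
    have hh := h t φ ht' hφ'
    simp only [smul_eq_mul, polarCoord_symm_apply]
    have e2 : ∀ z : ℝ, (t * Real.cos φ) ^ 2 + (t * Real.sin φ) ^ 2 + z ^ 2 = t ^ 2 + z ^ 2 := by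
      intro z
      have := Real.sin_sq_add_cos_sq φ
      linear_combination t ^ 2 * this
    by_cases hc : φ ∈ J
    · have : (t * Real.cos φ, t * Real.sin φ) ∈ A := hh.2 hc
      simp [hc, Set.preimage, this, e2]
    · have : (t * Real.cos φ, t * Real.sin φ) ∉ A := fun hx => hc (hh.1 hx)
      simp [hc, Set.preimage, this]
  rw [e1, hprod]
  rw [lintegral_prod_mul (f := fun t : ℝ => ENNReal.ofReal t * volume {z : ℝ | t ^ 2 + z ^ 2 ≤ ρ ^ 2})
    (g := J.indicator 1)]
  · rw [lintegral_indicator_one hJ, Measure.restrict_apply hJ]; rfl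
  · exact ((ENNReal.measurable_ofReal).mul hmk).aemeasurable
  · exact (measurable_one.indicator hJ).aemeasurable

noncomputable def split3 (x : EuclideanSpace ℝ (Fin 3)) : (ℝ × ℝ) × ℝ := ((x 0, x 1), x 2)

lemma split3_mp : MeasurePreserving split3 := by
  have h1 := PiLp.volume_preserving_ofLp (Fin 3)
  have h2 := volume_preserving_piFinSuccAbove (fun _ : Fin 3 => ℝ) 2
  have h3 := (volume_preserving_finTwoArrow ℝ)
  have h4 := (h3.prod (MeasurePreserving.id (volume : Measure ℝ)))
  have h5 : MeasurePreserving (Prod.swap : ℝ × (Fin 2 → ℝ) → (Fin 2 → ℝ) × ℝ) volume volume :=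
    Measure.measurePreserving_swap
  have := h4.comp (h5.comp (h2.comp h1))
  convert this using 1
  · funext x
    rfl
  · rfl

lemma vol_split (b : OrthonormalBasis (Fin 3) ℝ (EuclideanSpace ℝ (Fin 3)))
    (S : Set ((ℝ × ℝ) × ℝ)) (hS : MeasurableSet S) :
    volume ((fun x => split3 (b.repr x)) ⁻¹' S) = volume S := by
  have := split3_mp.comp b.measurePreserving_repr
  exact this.measure_preimage hS.nullMeasurableSet

lemma ball_split (b : OrthonormalBasis (Fin 3) ℝ (EuclideanSpace ℝ (Fin 3))) (ρ : ℝ) (hρ : 0 ≤ ρ)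
    (x : EuclideanSpace ℝ (Fin 3)) :
    x ∈ closedBall (0 : EuclideanSpace ℝ (Fin 3)) ρ ↔
      (b.repr x 0) ^ 2 + (b.repr x 1) ^ 2 + (b.repr x 2) ^ 2 ≤ ρ ^ 2 := by
  rw [mem_closedBall_zero_iff, ← b.repr.norm_map, EuclideanSpace.norm_eq, Real.sqrt_le_left hρ]
  simp [Fin.sum_univ_three]

lemma meas_set (ρ : ℝ) (A : Set (ℝ × ℝ)) (hA : MeasurableSet A) :
    MeasurableSet {q : (ℝ × ℝ) × ℝ | q.1.1 ^ 2 + q.1.2 ^ 2 + q.2 ^ 2 ≤ ρ ^ 2 ∧ q.1 ∈ A} := by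
  have hm1 : MeasurableSet {q : (ℝ × ℝ) × ℝ | q.1.1 ^ 2 + q.1.2 ^ 2 + q.2 ^ 2 ≤ ρ ^ 2} :=
    measurableSet_le (by fun_prop) (by fun_prop)
  exact hm1.inter (measurable_fst hA)

lemma radK_eq (ρ : ℝ) (hρ : 0 ≤ ρ) : radK ρ = ENNReal.ofReal (2 / 3 * ρ ^ 3) := by
  have h := vol_angular ρ Set.univ MeasurableSet.univ Set.univ MeasurableSet.univ (by simp)
  have hm1 : MeasurableSet {q : (ℝ × ℝ) × ℝ | q.1.1 ^ 2 + q.1.2 ^ 2 + q.2 ^ 2 ≤ ρ ^ 2 ∧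
      q.1 ∈ Set.univ} :=
    meas_set ρ _ MeasurableSet.univ
  rw [← vol_split (EuclideanSpace.basisFun (Fin 3) ℝ) _ hm1] at h
  have e : ((fun x => split3 ((EuclideanSpace.basisFun (Fin 3) ℝ).repr x)) ⁻¹'
      {q : (ℝ × ℝ) × ℝ | q.1.1 ^ 2 + q.1.2 ^ 2 + q.2 ^ 2 ≤ ρ ^ 2 ∧ q.1 ∈ Set.univ}) =
      closedBall (0 : EuclideanSpace ℝ (Fin 3)) ρ := by
    ext x
    rw [ball_split (EuclideanSpace.basisFun (Fin 3) ℝ) ρ hρ]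
    simp [split3]
  rw [e, EuclideanSpace.volume_closedBall_fin_three, Set.univ_inter, Real.volume_Ioo] at h
  have hpi := Real.pi_pos
  have h2 : ENNReal.ofReal (Real.pi - -Real.pi) ≠ 0 := by
    simp; linarith
  have h3 := (ENNReal.eq_div_iff h2 ENNReal.ofReal_ne_top).2 ((mul_comm _ _).trans h.symm)
  rw [h3, ← ENNReal.ofReal_pow hρ, ← ENNReal.ofReal_mul (by positivity),
    ← ENNReal.ofReal_div_of_pos (by linarith)]
  congr 1
  field_simp
  ring

lemma wedge_basis (n₁ n₂ : EuclideanSpace ℝ (Fin 3)) (h1 : n₁ ≠ 0) (h2 : n₂ ≠ 0)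
    (hs : 0 < Real.sin (InnerProductGeometry.angle n₁ n₂)) :
    ∃ b : OrthonormalBasis (Fin 3) ℝ (EuclideanSpace ℝ (Fin 3)),
      (∀ x, inner ℝ n₁ x = ‖n₁‖ * b.repr x 0) ∧
      (∀ x, inner ℝ n₂ x = ‖n₂‖ * (Real.cos (InnerProductGeometry.angle n₁ n₂) * b.repr x 0 +
        Real.sin (InnerProductGeometry.angle n₁ n₂) * b.repr x 1)) := by
  set ψ := InnerProductGeometry.angle n₁ n₂ with hψ
  have hψ0 : 0 ≤ ψ := InnerProductGeometry.angle_nonneg _ _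
  have hψ1 : ψ ≤ Real.pi := InnerProductGeometry.angle_le_pi _ _
  have hψ0' : 0 < ψ := lt_of_le_of_ne hψ0 (by intro h; rw [← h] at hs; simp at hs)
  have hψ1' : ψ < Real.pi := lt_of_le_of_ne hψ1 (by intro h; rw [h] at hs; simp at hs)
  have hn1 : 0 < ‖n₁‖ := norm_pos_iff.2 h1
  have hn2 : 0 < ‖n₂‖ := norm_pos_iff.2 h2
  have hin : Real.cos ψ * (‖n₁‖ * ‖n₂‖) = inner ℝ n₁ n₂ :=
    InnerProductGeometry.cos_angle_mul_norm_mul_norm n₁ n₂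
  set e0 : EuclideanSpace ℝ (Fin 3) := ‖n₁‖⁻¹ • n₁ with he0
  set e1 : EuclideanSpace ℝ (Fin 3) :=
    (Real.sin ψ)⁻¹ • (‖n₂‖⁻¹ • n₂ - Real.cos ψ • e0) with he1
  have i00 : inner ℝ e0 e0 = (1:ℝ) := by
    rw [he0, inner_smul_left, inner_smul_right, real_inner_self_eq_norm_sq]
    simp; field_simp
  have i0n : inner ℝ e0 n₂ = Real.cos ψ * ‖n₂‖ := by
    rw [he0, inner_smul_left, ← hin]; simp; field_simp
  have i01 : inner ℝ e0 e1 = (0:ℝ) := by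
    rw [he1, inner_smul_right, inner_sub_right, inner_smul_right, inner_smul_right, i00, i0n]
    field_simp; ring
  have i11 : inner ℝ e1 e1 = (1:ℝ) := by
    have hsc := Real.sin_sq_add_cos_sq ψ
    rw [he1, inner_smul_left, inner_smul_right, inner_sub_right, inner_sub_left, inner_sub_left]
    simp only [inner_smul_left, inner_smul_right, real_inner_self_eq_norm_sq n₂]
    rw [i00, i0n, real_inner_comm, i0n]
    simp
    field_simp
    linear_combination -hsc
  let v : Fin 3 → EuclideanSpace ℝ (Fin 3) := ![e0, e1, 0]
  have ho : Orthonormal ℝ (({0, 1} : Set (Fin 3)).domRestrict v) := by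
    rw [orthonormal_iff_ite]
    rintro ⟨i, hi⟩ ⟨j, hj⟩
    have hi' : i = 0 ∨ i = 1 := by simpa using hi
    have hj' : j = 0 ∨ j = 1 := by simpa using hj
    simp only [Subtype.mk.injEq]
    change inner ℝ (v i) (v j) = _
    rcases hi' with h | h <;> rcases hj' with h' | h' <;> subst h <;> subst h'
    · rw [if_pos rfl]; exact i00
    · rw [if_neg (by decide)]; exact i01
    · rw [real_inner_comm, if_neg (by decide)]; exact i01
    · rw [if_pos rfl]; exact i11
  obtain ⟨b, hb⟩ := ho.exists_orthonormalBasis_extension_of_card_eq (by simp)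
  have hb0 : b 0 = e0 := hb 0 (by simp)
  have hb1 : b 1 = e1 := hb 1 (by simp)
  refine ⟨b, ?_, ?_⟩
  · intro x
    rw [b.repr_apply_apply, hb0, he0, inner_smul_left]; simp; field_simp
  · intro x
    rw [b.repr_apply_apply, b.repr_apply_apply, hb0, hb1, he1, inner_smul_left (‖n₂‖⁻¹ • n₂ - Real.cos ψ • e0), inner_sub_left,
      inner_smul_left, inner_smul_left, he0, inner_smul_left, inner_smul_left]; simp; field_simp; ring

lemma wedge_ang (ψ : ℝ) (hψ0' : 0 < ψ) (hψ1' : ψ < Real.pi) (t φ : ℝ) (ht : 0 < t)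
    (hφ1 : -Real.pi < φ) (hφ2 : φ < Real.pi) :
    (0 ≤ t * Real.cos φ ∧ 0 ≤ Real.cos ψ * (t * Real.cos φ) + Real.sin ψ * (t * Real.sin φ)) ↔
      (ψ - Real.pi / 2 ≤ φ ∧ φ ≤ Real.pi / 2) := by
  have q1 : 0 ≤ t * Real.cos φ ↔ 0 ≤ Real.cos φ := mul_nonneg_iff_of_pos_left ht
  have q2 : 0 ≤ Real.cos ψ * (t * Real.cos φ) + Real.sin ψ * (t * Real.sin φ) ↔
      0 ≤ Real.cos (ψ - φ) := by
    rw [Real.cos_sub, ← mul_nonneg_iff_of_pos_left ht (b := Real.cos ψ * Real.cos φ + _)]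
    ring_nf
  rw [q1, q2]
  constructor
  · rintro ⟨c1, c2⟩
    have a1 : φ ≤ Real.pi / 2 := by
      by_contra hcon
      push Not at hcon
      have := Real.cos_neg_of_pi_div_two_lt_of_lt hcon (by linarith)
      linarith
    have a2 : -(Real.pi / 2) ≤ φ := by
      by_contra hcon
      push Not at hcon
      have := Real.cos_neg_of_pi_div_two_lt_of_lt (x := -φ) (by linarith) (by linarith)
      rw [Real.cos_neg] at this
      linarith
    refine ⟨?_, a1⟩
    by_contra hcon
    push Not at hcon
    have := Real.cos_neg_of_pi_div_two_lt_of_lt (x := ψ - φ) (by linarith) (by linarith)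
    linarith
  · rintro ⟨c1, c2⟩
    exact ⟨Real.cos_nonneg_of_neg_pi_div_two_le_of_le (by linarith) c2,
      Real.cos_nonneg_of_neg_pi_div_two_le_of_le (by linarith) (by linarith)⟩

lemma wedge (n₁ n₂ : EuclideanSpace ℝ (Fin 3)) (h1 : n₁ ≠ 0) (h2 : n₂ ≠ 0)
    (hs : 0 < Real.sin (InnerProductGeometry.angle n₁ n₂)) (ρ : ℝ) (hρ : 0 ≤ ρ) :
    volume.real (closedBall (0 : EuclideanSpace ℝ (Fin 3)) ρ ∩
      {x | 0 ≤ inner ℝ n₁ x ∧ 0 ≤ inner ℝ n₂ x}) =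
      2 / 3 * ρ ^ 3 * (Real.pi - InnerProductGeometry.angle n₁ n₂) := by
  set ψ := InnerProductGeometry.angle n₁ n₂ with hψ
  have hψ0 : 0 ≤ ψ := InnerProductGeometry.angle_nonneg _ _
  have hψ1 : ψ ≤ Real.pi := InnerProductGeometry.angle_le_pi _ _
  have hψ0' : 0 < ψ := lt_of_le_of_ne hψ0 (by intro h; rw [← h] at hs; simp at hs)
  have hψ1' : ψ < Real.pi := lt_of_le_of_ne hψ1 (by intro h; rw [h] at hs; simp at hs)
  have hn1 : 0 < ‖n₁‖ := norm_pos_iff.2 h1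
  have hn2 : 0 < ‖n₂‖ := norm_pos_iff.2 h2
  obtain ⟨b, hd1, hd2⟩ := wedge_basis n₁ n₂ h1 h2 hs
  rw [← hψ] at hd2
  let A : Set (ℝ × ℝ) := {p | 0 ≤ p.1 ∧ 0 ≤ Real.cos ψ * p.1 + Real.sin ψ * p.2}
  have hA : MeasurableSet A :=
    MeasurableSet.inter (s₁ := {p : ℝ × ℝ | 0 ≤ p.1})
      (s₂ := {p : ℝ × ℝ | 0 ≤ Real.cos ψ * p.1 + Real.sin ψ * p.2})
      (measurableSet_le (by fun_prop) (by fun_prop))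
      (measurableSet_le (by fun_prop) (by fun_prop))
  have hv := vol_angular ρ A hA (Set.Icc (ψ - Real.pi / 2) (Real.pi / 2)) measurableSet_Icc (by
    rintro t φ ht ⟨hφ1, hφ2⟩
    exact wedge_ang ψ hψ0' hψ1' t φ ht hφ1 hφ2)
  have hm1 : MeasurableSet {q : (ℝ × ℝ) × ℝ | q.1.1 ^ 2 + q.1.2 ^ 2 + q.2 ^ 2 ≤ ρ ^ 2 ∧
      q.1 ∈ A} :=
    meas_set ρ A hA
  rw [← vol_split b _ hm1] at hv
  have e : ((fun x => split3 (b.repr x)) ⁻¹'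
      {q : (ℝ × ℝ) × ℝ | q.1.1 ^ 2 + q.1.2 ^ 2 + q.2 ^ 2 ≤ ρ ^ 2 ∧ q.1 ∈ A}) =
      closedBall (0 : EuclideanSpace ℝ (Fin 3)) ρ ∩
      {x | 0 ≤ inner ℝ n₁ x ∧ 0 ≤ inner ℝ n₂ x} := by
    ext x
    simp only [Set.mem_preimage, Set.mem_ofPred_eq, Set.mem_inter_iff, ball_split b ρ hρ, hd1, hd2,
      split3, A, mul_nonneg_iff_of_pos_left hn1, mul_nonneg_iff_of_pos_left hn2]
  have hsub : Set.Icc (ψ - Real.pi / 2) (Real.pi / 2) ∩ Set.Ioo (-Real.pi) Real.pi =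
      Set.Icc (ψ - Real.pi / 2) (Real.pi / 2) := by
    apply Set.inter_eq_left.2
    rintro y ⟨y1, y2⟩
    have := Real.pi_pos
    constructor <;> linarith
  rw [e, hsub, Real.volume_Icc, radK_eq ρ hρ, ← ENNReal.ofReal_mul (by positivity)] at hv
  rw [Measure.real, hv, ENNReal.toReal_ofReal]
  · ring
  · apply mul_nonneg
    · positivity
    · linarith

-- Part Girard


lemma null_plane (n : EuclideanSpace ℝ (Fin 3)) (hn : n ≠ 0) :
    volume {x : EuclideanSpace ℝ (Fin 3) | inner ℝ n x = 0} = 0 := by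
  have h := Measure.addHaar_submodule (volume : Measure (EuclideanSpace ℝ (Fin 3)))
    (LinearMap.ker (innerSL ℝ n : EuclideanSpace ℝ (Fin 3) →L[ℝ] ℝ).toLinearMap) (by
      intro h
      have : n ∈ (LinearMap.ker (innerSL ℝ n : EuclideanSpace ℝ (Fin 3) →L[ℝ] ℝ).toLinearMap) := by
        rw [h]; trivial
      simp at this
      exact hn this)
  convert h using 2
  ext x; simp

lemma ball_neg_inv (ρ : ℝ) (S : Set (EuclideanSpace ℝ (Fin 3))) :
    (volume.restrict (closedBall (0 : EuclideanSpace ℝ (Fin 3)) ρ)).real ((fun x => -x) ⁻¹' S) =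
    (volume.restrict (closedBall (0 : EuclideanSpace ℝ (Fin 3)) ρ)).real S := by
  rw [Measure.real, Measure.real, Measure.restrict_apply' measurableSet_closedBall,
    Measure.restrict_apply' measurableSet_closedBall]
  congr 1
  have := Measure.measure_preimage_neg (volume : Measure (EuclideanSpace ℝ (Fin 3)))
    (S ∩ closedBall 0 ρ)
  rw [← this]
  congr 1
  ext x
  simp

lemma girard (n₁ n₂ n₃ : EuclideanSpace ℝ (Fin 3)) (h1 : n₁ ≠ 0) (h2 : n₂ ≠ 0) (h3 : n₃ ≠ 0)
    (h12 : 0 < Real.sin (InnerProductGeometry.angle n₁ n₂))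
    (h13 : 0 < Real.sin (InnerProductGeometry.angle n₁ n₃))
    (h23 : 0 < Real.sin (InnerProductGeometry.angle n₂ n₃)) (ρ : ℝ) (hρ : 0 ≤ ρ) :
    volume.real (closedBall (0 : EuclideanSpace ℝ (Fin 3)) ρ ∩
      {x | 0 ≤ inner ℝ n₁ x ∧ 0 ≤ inner ℝ n₂ x ∧ 0 ≤ inner ℝ n₃ x}) =
      1 / 3 * ρ ^ 3 * (2 * Real.pi - InnerProductGeometry.angle n₁ n₂
        - InnerProductGeometry.angle n₁ n₃ - InnerProductGeometry.angle n₂ n₃) := by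
  have w12 := wedge n₁ n₂ h1 h2 h12 ρ hρ
  have w13 := wedge n₁ n₃ h1 h3 h13 ρ hρ
  have w23 := wedge n₂ n₃ h2 h3 h23 ρ hρ
  set μ := volume.restrict (closedBall (0 : EuclideanSpace ℝ (Fin 3)) ρ) with hμ
  have hconv : ∀ S, volume.real (closedBall (0 : EuclideanSpace ℝ (Fin 3)) ρ ∩ S) = μ.real S := by
    intro S
    rw [hμ, measureReal_restrict_apply' measurableSet_closedBall, Set.inter_comm]
  haveI : IsFiniteMeasure μ := ⟨by
    rw [hμ, Measure.restrict_apply_univ]; exact measure_closedBall_lt_top⟩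
  have hH : ∀ n : EuclideanSpace ℝ (Fin 3), MeasurableSet {x | 0 ≤ inner ℝ n x} := fun n =>
    measurableSet_le (by fun_prop) (by fun_prop)
  have hae : ∀ n : EuclideanSpace ℝ (Fin 3), n ≠ 0 → ∀ᵐ x ∂μ, inner ℝ n x ≠ 0 := by
    intro n hn
    apply ae_restrict_of_ae
    rw [ae_iff]
    simpa using null_plane n hn
  set H1 := {x | 0 ≤ inner ℝ n₁ x} with hH1
  set H2 := {x | 0 ≤ inner ℝ n₂ x} with hH2
  set H3 := {x | 0 ≤ inner ℝ n₃ x} with hH3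
  have m1 : MeasurableSet H1 := hH n₁
  have m2 : MeasurableSet H2 := hH n₂
  have m3 : MeasurableSet H3 := hH n₃
  rw [hconv] at w12 w13 w23 ⊢
  have e12 : {x | 0 ≤ inner ℝ n₁ x ∧ 0 ≤ inner ℝ n₂ x} = H1 ∩ H2 := rfl
  have e13 : {x | 0 ≤ inner ℝ n₁ x ∧ 0 ≤ inner ℝ n₃ x} = H1 ∩ H3 := rfl
  have e23 : {x | 0 ≤ inner ℝ n₂ x ∧ 0 ≤ inner ℝ n₃ x} = H2 ∩ H3 := rfl
  have e123 : {x | 0 ≤ inner ℝ n₁ x ∧ 0 ≤ inner ℝ n₂ x ∧ 0 ≤ inner ℝ n₃ x} = H1 ∩ (H2 ∩ H3) := rfl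
  rw [e12] at w12
  rw [e13] at w13
  rw [e23] at w23
  rw [e123]
  have a1 := measureReal_inter_add_sdiff (μ := μ) (s := H1) m2
  have a2 := measureReal_inter_add_sdiff (μ := μ) (s := H1 \ H2) m3
  have a3 := measureReal_inter_add_sdiff (μ := μ) (s := H1 ∩ H3) m2
  have a4 := measureReal_inter_add_sdiff (μ := μ) (s := H2 ∩ H3) m1
  have s1 : (H2 ∩ H3) ∩ H1 = H1 ∩ (H2 ∩ H3) := Set.inter_comm _ _
  have s2 : H1 ∩ H3 ∩ H2 = H1 ∩ (H2 ∩ H3) := by ext x; simp only [Set.mem_inter_iff]; tauto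
  have s3 : (H1 ∩ H3) \ H2 = (H1 \ H2) ∩ H3 := by
    ext x; simp only [Set.mem_inter_iff, Set.mem_diff]; tauto
  rw [s1] at a4
  rw [s2, s3] at a3
  have b1 : μ.real ((H1 \ H2) \ H3) = μ.real ((H2 ∩ H3) \ H1) := by
    rw [← ball_neg_inv ρ ((H2 ∩ H3) \ H1)]
    apply measureReal_congr
    filter_upwards [hae n₁ h1, hae n₂ h2, hae n₃ h3] with x q1 q2 q3
    apply propext
    change ((0 ≤ inner ℝ n₁ x ∧ ¬ 0 ≤ inner ℝ n₂ x) ∧ ¬ 0 ≤ inner ℝ n₃ x) ↔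
      ((0 ≤ inner ℝ n₂ (-x) ∧ 0 ≤ inner ℝ n₃ (-x)) ∧ ¬ 0 ≤ inner ℝ n₁ (-x))
    simp only [inner_neg_right, not_le, Left.nonneg_neg_iff, Left.neg_neg_iff]
    constructor
    · rintro ⟨⟨p1, p2⟩, p3⟩
      exact ⟨⟨p2.le, p3.le⟩, lt_of_le_of_ne p1 (Ne.symm q1)⟩
    · rintro ⟨⟨p2, p3⟩, p1⟩
      exact ⟨⟨p1.le, lt_of_le_of_ne p2 q2⟩, lt_of_le_of_ne p3 q3⟩
  have b2 : μ.real H1ᶜ = μ.real H1 := by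
    rw [← ball_neg_inv ρ H1]
    apply measureReal_congr
    filter_upwards [hae n₁ h1] with x q1
    apply propext
    change (¬ 0 ≤ inner ℝ n₁ x) ↔ (0 ≤ inner ℝ n₁ (-x))
    simp only [inner_neg_right, not_le, Left.nonneg_neg_iff]
    exact ⟨le_of_lt, fun p => lt_of_le_of_ne p q1⟩
  have b3 := measureReal_add_measureReal_compl (μ := μ) m1
  have b4 : μ.real Set.univ = 4 / 3 * Real.pi * ρ ^ 3 := by
    rw [← hconv, Set.inter_univ, Measure.real, EuclideanSpace.volume_closedBall_fin_three,
      ← ENNReal.ofReal_pow hρ, ← ENNReal.ofReal_mul (by positivity), ENNReal.toReal_ofReal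
        (by positivity)]
    ring
  linarith

-- Part Sector


noncomputable def dih (a b c ab ac bc : ℝ) : ℝ :=
  Real.arccos ((bc * a - ab * ac) / (Real.sqrt (a * b - ab ^ 2) * Real.sqrt (a * c - ac ^ 2)))

def gdet (a b c ab ac bc : ℝ) : ℝ :=
  a * b * c + 2 * ab * ac * bc - a * bc ^ 2 - b * ac ^ 2 - c * ab ^ 2

noncomputable def nrm (u v w : EuclideanSpace ℝ (Fin 3)) : EuclideanSpace ℝ (Fin 3) :=
  (inner ℝ v v * inner ℝ w w - inner ℝ v w ^ 2) • u +
  (inner ℝ u w * inner ℝ v w - inner ℝ u v * inner ℝ w w) • v +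
  (inner ℝ u v * inner ℝ v w - inner ℝ u w * inner ℝ v v) • w

lemma nrm_self (u v w : EuclideanSpace ℝ (Fin 3)) : inner ℝ (nrm u v w) u =
    gdet (inner ℝ u u) (inner ℝ v v) (inner ℝ w w) (inner ℝ u v) (inner ℝ u w) (inner ℝ v w) := by
  simp only [nrm, gdet, inner_add_left, real_inner_smul_left]
  rw [real_inner_comm u v, real_inner_comm u w]
  ring

lemma nrm_v (u v w : EuclideanSpace ℝ (Fin 3)) : inner ℝ (nrm u v w) v = 0 := by
  simp only [nrm, inner_add_left, real_inner_smul_left]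
  rw [real_inner_comm v w]
  ring

lemma nrm_w (u v w : EuclideanSpace ℝ (Fin 3)) : inner ℝ (nrm u v w) w = 0 := by
  simp only [nrm, inner_add_left, real_inner_smul_left]
  ring

lemma nrm_nrm (u v w n : EuclideanSpace ℝ (Fin 3)) : inner ℝ n (nrm u v w) =
    (inner ℝ v v * inner ℝ w w - inner ℝ v w ^ 2) * inner ℝ n u +
  (inner ℝ u w * inner ℝ v w - inner ℝ u v * inner ℝ w w) * inner ℝ n v +
  (inner ℝ u v * inner ℝ v w - inner ℝ u w * inner ℝ v v) * inner ℝ n w := by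
  simp only [nrm, inner_add_right, real_inner_smul_right]

def Ind (u v w : EuclideanSpace ℝ (Fin 3)) : Prop :=
  ∀ a b c : ℝ, a • u + b • v + c • w = 0 → a = 0 ∧ b = 0 ∧ c = 0

lemma Ind.rot {u v w : EuclideanSpace ℝ (Fin 3)} (h : Ind u v w) : Ind v w u := by
  intro a b c e
  have := h c a b (by rw [← e]; abel)
  tauto

lemma cs_strict {u v w : EuclideanSpace ℝ (Fin 3)} (h : Ind u v w) :
    0 < inner ℝ v v * inner ℝ w w - inner ℝ v w ^ 2 := by
  have hv : 0 < inner ℝ v v := by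
    rw [real_inner_self_eq_norm_sq]
    have : v ≠ 0 := by
      rintro rfl
      have := h 0 1 0 (by simp)
      simp at this
    positivity
  have hm : (inner ℝ v v) • w - (inner ℝ v w) • v ≠ 0 := by
    intro e
    have := h 0 (-inner ℝ v w) (inner ℝ v v) (by rw [← e, zero_smul, neg_smul]; abel)
    exact hv.ne' this.2.2
  have h1 : 0 < inner ℝ ((inner ℝ v v) • w - (inner ℝ v w) • v)
      ((inner ℝ v v) • w - (inner ℝ v w) • v) := by
    rw [real_inner_self_eq_norm_sq]; positivity
  have h2 : inner ℝ ((inner ℝ v v) • w - (inner ℝ v w) • v)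
      ((inner ℝ v v) • w - (inner ℝ v w) • v) =
      inner ℝ v v * (inner ℝ v v * inner ℝ w w - inner ℝ v w ^ 2) := by
    simp only [inner_sub_left, inner_sub_right, real_inner_smul_left, real_inner_smul_right]
    rw [real_inner_comm v w]
    ring
  rw [h2] at h1
  exact pos_of_mul_pos_right h1 hv.le

lemma nrm_sq (u v w : EuclideanSpace ℝ (Fin 3)) : inner ℝ (nrm u v w) (nrm u v w) =
    (inner ℝ v v * inner ℝ w w - inner ℝ v w ^ 2) *
    gdet (inner ℝ u u) (inner ℝ v v) (inner ℝ w w) (inner ℝ u v) (inner ℝ u w) (inner ℝ v w) := by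
  rw [nrm_nrm, nrm_self, nrm_v, nrm_w]; ring

lemma nrm_ne {u v w : EuclideanSpace ℝ (Fin 3)} (h : Ind u v w) : nrm u v w ≠ 0 := by
  intro e
  have := h _ _ _ e
  exact (cs_strict h).ne' this.1

lemma gdet_pos {u v w : EuclideanSpace ℝ (Fin 3)} (h : Ind u v w) :
    0 < gdet (inner ℝ u u) (inner ℝ v v) (inner ℝ w w) (inner ℝ u v) (inner ℝ u w)
      (inner ℝ v w) := by
  have h1 : 0 < inner ℝ (nrm u v w) (nrm u v w) := by
    rw [real_inner_self_eq_norm_sq]; have := nrm_ne h; positivity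
  rw [nrm_sq] at h1
  exact pos_of_mul_pos_right h1 (cs_strict h).le

lemma gdet_rot (a b c ab ac bc : ℝ) : gdet b c a bc ab ac = gdet a b c ab ac bc := by
  unfold gdet; ring

lemma ang_nrm {u v w : EuclideanSpace ℝ (Fin 3)} (h : Ind u v w) :
    InnerProductGeometry.angle (nrm v w u) (nrm w u v) = Real.pi -
      dih (inner ℝ u u) (inner ℝ v v) (inner ℝ w w) (inner ℝ u v) (inner ℝ u w) (inner ℝ v w) ∧
    0 < Real.sin (InnerProductGeometry.angle (nrm v w u) (nrm w u v)) := by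
  have hP := cs_strict h.rot.rot
  have hQ := cs_strict h.rot
  have hD := gdet_pos h
  have e1 : ‖nrm v w u‖ = Real.sqrt (inner ℝ w w * inner ℝ u u - inner ℝ w u ^ 2) * Real.sqrt
      (gdet (inner ℝ u u) (inner ℝ v v) (inner ℝ w w) (inner ℝ u v) (inner ℝ u w)
      (inner ℝ v w)) := by
    rw [← Real.sqrt_mul hQ.le, norm_eq_sqrt_real_inner, nrm_sq, real_inner_comm u v,
      real_inner_comm u w, gdet_rot]
  have e2 : ‖nrm w u v‖ = Real.sqrt (inner ℝ u u * inner ℝ v v - inner ℝ u v ^ 2) * Real.sqrt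
      (gdet (inner ℝ u u) (inner ℝ v v) (inner ℝ w w) (inner ℝ u v) (inner ℝ u w)
      (inner ℝ v w)) := by
    rw [← Real.sqrt_mul hP.le, norm_eq_sqrt_real_inner, nrm_sq, real_inner_comm u w,
      real_inner_comm v w, ← gdet_rot]
  have e3 : inner ℝ (nrm v w u) (nrm w u v) = - (inner ℝ v w * inner ℝ u u - inner ℝ u v *
      inner ℝ u w) * gdet (inner ℝ u u) (inner ℝ v v) (inner ℝ w w) (inner ℝ u v) (inner ℝ u w)
      (inner ℝ v w) := by
    rw [nrm_nrm, nrm_self, nrm_v, nrm_w, real_inner_comm u v,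
      real_inner_comm u w, real_inner_comm v w, gdet_rot]
    ring
  have key : inner ℝ (nrm v w u) (nrm w u v) / (‖nrm v w u‖ * ‖nrm w u v‖) =
    - ((inner ℝ v w * inner ℝ u u - inner ℝ u v * inner ℝ u w) /
      (Real.sqrt (inner ℝ u u * inner ℝ v v - inner ℝ u v ^ 2) *
       Real.sqrt (inner ℝ u u * inner ℝ w w - inner ℝ u w ^ 2))) := by
    rw [e1, e2, e3, real_inner_comm u w, mul_comm (inner ℝ w w)]
    rw [real_inner_comm u w, mul_comm (inner ℝ w w)] at hQ
    set Δ := gdet (inner ℝ u u) (inner ℝ v v) (inner ℝ w w) (inner ℝ u v) (inner ℝ u w)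
      (inner ℝ v w)
    have s1 := Real.sqrt_pos.2 hP
    have s2 := Real.sqrt_pos.2 hQ
    have s3 := Real.sqrt_pos.2 hD
    rw [neg_mul, neg_div]
    congr 1
    rw [div_eq_div_iff (by positivity) (by positivity)]
    nth_rw 1 [← Real.mul_self_sqrt hD.le]
    ring
  constructor
  · unfold InnerProductGeometry.angle dih
    rw [key, Real.arccos_neg]
  · unfold InnerProductGeometry.angle
    rw [Real.sin_arccos, key]
    apply Real.sqrt_pos.2
    rw [neg_sq, div_pow, mul_pow]
    rw [real_inner_comm u w, mul_comm (inner ℝ w w)] at hQ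
    rw [Real.sq_sqrt hP.le, Real.sq_sqrt hQ.le, sub_pos, div_lt_one (by positivity)]
    have hu : 0 < inner ℝ u u := by
      rcases lt_or_eq_of_le (real_inner_self_nonneg (x := u)) with h' | h'
      · exact h'
      · rw [← h'] at hP
        nlinarith [sq_nonneg (inner ℝ u v)]
    have := mul_pos hu hD
    unfold gdet at this
    nlinarith

def cone3 (u v w : EuclideanSpace ℝ (Fin 3)) : Set (EuclideanSpace ℝ (Fin 3)) :=
  {p | ∃ x y z : ℝ, 0 ≤ x ∧ 0 ≤ y ∧ 0 ≤ z ∧ p = x • u + y • v + z • w}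

lemma Ind.span {u v w : EuclideanSpace ℝ (Fin 3)} (h : Ind u v w) (p : EuclideanSpace ℝ (Fin 3)) :
    ∃ x y z : ℝ, p = x • u + y • v + z • w := by
  have hl : LinearIndependent ℝ ![u, v, w] := by
    rw [Fintype.linearIndependent_iff]
    intro g hg
    have := h (g 0) (g 1) (g 2) (by simpa [Fin.sum_univ_three] using hg)
    intro i
    fin_cases i <;> simp <;> tauto
  let b := basisOfLinearIndependentOfCardEqFinrank hl (by simp)
  have := b.sum_repr p
  rw [Fin.sum_univ_three] at this
  simp [b] at this
  exact ⟨_, _, _, this.symm⟩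

lemma inner_nrm (u v w : EuclideanSpace ℝ (Fin 3)) (x y z : ℝ) :
    inner ℝ (nrm u v w) (x • u + y • v + z • w) = x * gdet (inner ℝ u u) (inner ℝ v v) (inner ℝ w w)
      (inner ℝ u v) (inner ℝ u w) (inner ℝ v w) := by
  simp only [inner_add_right, real_inner_smul_right, nrm_self, nrm_v, nrm_w]; ring

lemma cone3_eq {u v w : EuclideanSpace ℝ (Fin 3)} (h : Ind u v w) :
    cone3 u v w = {p | 0 ≤ inner ℝ (nrm u v w) p ∧ 0 ≤ inner ℝ (nrm v w u) p ∧
      0 ≤ inner ℝ (nrm w u v) p} := by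
  ext p
  obtain ⟨x, y, z, rfl⟩ := h.span p
  have i1 := inner_nrm u v w x y z
  have i2 := inner_nrm v w u y z x
  have i3 := inner_nrm w u v z x y
  rw [show y • v + z • w + x • u = x • u + y • v + z • w by abel] at i2
  rw [show z • w + x • u + y • v = x • u + y • v + z • w by abel] at i3
  have d1 := gdet_pos h
  have d2 := gdet_pos h.rot
  have d3 := gdet_pos h.rot.rot
  change _ ↔ (0 ≤ inner ℝ (nrm u v w) _ ∧ 0 ≤ inner ℝ (nrm v w u) _ ∧ 0 ≤ inner ℝ (nrm w u v) _)
  rw [i1, i2, i3, mul_nonneg_iff_of_pos_right d1, mul_nonneg_iff_of_pos_right d2,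
    mul_nonneg_iff_of_pos_right d3]
  constructor
  · rintro ⟨x', y', z', hx, hy, hz, e⟩
    have := h (x - x') (y - y') (z - z') (by
      rw [← sub_eq_zero] at e
      rw [← e, sub_smul, sub_smul, sub_smul]; abel)
    refine ⟨?_, ?_, ?_⟩ <;> linarith
  · rintro ⟨hx, hy, hz⟩
    exact ⟨x, y, z, hx, hy, hz, rfl⟩

lemma sector {u v w : EuclideanSpace ℝ (Fin 3)} (h : Ind u v w) (ρ : ℝ) (hρ : 0 ≤ ρ) :
    volume.real (closedBall (0 : EuclideanSpace ℝ (Fin 3)) ρ ∩ cone3 u v w) = 1 / 3 * ρ ^ 3 *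
    (dih (inner ℝ u u) (inner ℝ v v) (inner ℝ w w) (inner ℝ u v) (inner ℝ u w) (inner ℝ v w) +
     dih (inner ℝ v v) (inner ℝ w w) (inner ℝ u u) (inner ℝ v w) (inner ℝ v u) (inner ℝ w u) +
     dih (inner ℝ w w) (inner ℝ u u) (inner ℝ v v) (inner ℝ w u) (inner ℝ w v) (inner ℝ u v)
     - Real.pi) := by
  obtain ⟨a1, s1⟩ := ang_nrm h
  obtain ⟨a2, s2⟩ := ang_nrm h.rot
  obtain ⟨a3, s3⟩ := ang_nrm h.rot.rot
  rw [InnerProductGeometry.angle_comm] at a2 s2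
  rw [cone3_eq h, girard (nrm u v w) (nrm v w u) (nrm w u v) (nrm_ne h) (nrm_ne h.rot)
    (nrm_ne h.rot.rot) s3 s2 s1 ρ hρ, a1, a2, a3]
  ring

-- Part Geo

lemma tetra_perm (A B C D : EuclideanSpace ℝ (Fin 3)) : tetra B C D A = tetra A B C D := by
  unfold tetra
  congr 1
  ext x
  simp only [Set.mem_insert_iff, Set.mem_singleton_iff]
  tauto

def simp3 (u v w : EuclideanSpace ℝ (Fin 3)) : Set (EuclideanSpace ℝ (Fin 3)) :=
  {p | ∃ x y z : ℝ, 0 ≤ x ∧ 0 ≤ y ∧ 0 ≤ z ∧ x + y + z ≤ 1 ∧ p = x • u + y • v + z • w}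

lemma tetra_mem (A B C D p : EuclideanSpace ℝ (Fin 3)) :
    p ∈ tetra A B C D ↔ p - D ∈ simp3 (A - D) (B - D) (C - D) := by
  constructor
  · intro hp
    have hsub : tetra A B C D ⊆ {q | q - D ∈ simp3 (A - D) (B - D) (C - D)} := by
      apply convexHull_min
      · intro q hq
        simp only [Set.mem_insert_iff, Set.mem_singleton_iff] at hq
        rcases hq with rfl | rfl | rfl | rfl
        · exact ⟨1, 0, 0, by norm_num, by norm_num, by norm_num, by norm_num, by simp⟩
        · exact ⟨0, 1, 0, by norm_num, by norm_num, by norm_num, by norm_num, by simp⟩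
        · exact ⟨0, 0, 1, by norm_num, by norm_num, by norm_num, by norm_num, by simp⟩
        · exact ⟨0, 0, 0, by norm_num, by norm_num, by norm_num, by norm_num, by simp⟩
      · rintro p ⟨x, y, z, hx, hy, hz, hs, e⟩ q ⟨x', y', z', hx', hy', hz', hs', e'⟩ s t hs0 ht0 hst
        refine ⟨s * x + t * x', s * y + t * y', s * z + t * z', by positivity, by positivity,
          by positivity, by nlinarith, ?_⟩
        have : s • p + t • q - D = s • (p - D) + t • (q - D) := by
          have ht : t = 1 - s := by linarith
          subst ht; module
        rw [this, e, e']
        module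
    exact hsub hp
  · rintro ⟨x, y, z, hx, hy, hz, hs, e⟩
    have hc := convex_convexHull ℝ ({A, B, C, D} : Set (EuclideanSpace ℝ (Fin 3)))
    have hs := hc.sum_mem (t := Finset.univ) (w := ![x, y, z, 1 - x - y - z]) (z := ![A, B, C, D])
      (by intro i _; fin_cases i <;> simp <;> linarith)
      (by simp [Fin.sum_univ_four])
      (by intro i _; apply subset_convexHull; fin_cases i <;> simp)
    have : p = ∑ i, (![x, y, z, 1 - x - y - z] : Fin 4 → ℝ) i • (![A, B, C, D] : Fin 4 → _) i := by
      rw [← sub_add_cancel p D, e]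
      simp [Fin.sum_univ_four]
      module
    rw [this]
    exact hs

lemma Ind_of {A B C D : EuclideanSpace ℝ (Fin 3)} (h : AffineIndependent ℝ ![A, B, C, D]) :
    Ind (A - D) (B - D) (C - D) := by
  intro a b c e
  rw [affineIndependent_iff] at h
  have := h Finset.univ ![a, b, c, -(a + b + c)] (by simp [Fin.sum_univ_four]) (by
    rw [← e]
    simp [Fin.sum_univ_four]
    module)
  have h0 := this 0 (by simp)
  have h1 := this 1 (by simp)
  have h2 := this 2 (by simp)
  simp at h0 h1 h2
  exact ⟨h0, h1, h2⟩

lemma Ind_perm {A B C D : EuclideanSpace ℝ (Fin 3)} (h : Ind (A - D) (B - D) (C - D)) :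
    Ind (B - A) (C - A) (D - A) := by
  intro a b c e
  have := h (-(a + b + c)) a b (by rw [← e]; module)
  obtain ⟨h1, h2, h3⟩ := this
  refine ⟨h2, h3, by linarith⟩

lemma inner_coord (u v : EuclideanSpace ℝ (Fin 3)) :
    inner ℝ u v = u 0 * v 0 + u 1 * v 1 + u 2 * v 2 := by
  simp [PiLp.inner_apply, Fin.sum_univ_three]
  ring

lemma vol_simp3 (u v w : EuclideanSpace ℝ (Fin 3)) :
    volume.real (simp3 u v w) = Real.sqrt (gdet (inner ℝ u u) (inner ℝ v v) (inner ℝ w w)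
      (inner ℝ u v) (inner ℝ u w) (inner ℝ v w)) *
      volume.real {p : EuclideanSpace ℝ (Fin 3) | 0 ≤ p 0 ∧ 0 ≤ p 1 ∧ 0 ≤ p 2 ∧ p 0 + p 1 + p 2 ≤ 1} := by
  set M : Matrix (Fin 3) (Fin 3) ℝ := !![u 0, v 0, w 0; u 1, v 1, w 1; u 2, v 2, w 2] with hM
  have hdet : M.det ^ 2 = gdet (inner ℝ u u) (inner ℝ v v) (inner ℝ w w)
      (inner ℝ u v) (inner ℝ u w) (inner ℝ v w) := by
    simp only [inner_coord, gdet, Matrix.det_fin_three, hM]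
    simp
    ring
  have himg : simp3 u v w = (Matrix.toLpLin 2 2 M) ''
      {p : EuclideanSpace ℝ (Fin 3) | 0 ≤ p 0 ∧ 0 ≤ p 1 ∧ 0 ≤ p 2 ∧ p 0 + p 1 + p 2 ≤ 1} := by
    have hf : ∀ p : EuclideanSpace ℝ (Fin 3), (Matrix.toLpLin 2 2 M) p =
        p 0 • u + p 1 • v + p 2 • w := by
      intro p
      ext i
      fin_cases i <;> simp [hM, Matrix.toLpLin_apply, Matrix.mulVec, dotProduct, Fin.sum_univ_three] <;> ring
    ext q
    constructor
    · rintro ⟨x, y, z, hx, hy, hz, hs, e⟩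
      refine ⟨!₂[x, y, z], ⟨by simpa using hx, by simpa using hy, by simpa using hz,
        by simpa using hs⟩, ?_⟩
      rw [hf, e]; simp
    · rintro ⟨p, ⟨hx, hy, hz, hs⟩, rfl⟩
      exact ⟨p 0, p 1, p 2, hx, hy, hz, hs, hf p⟩
  rw [himg, Measure.real, Measure.addHaar_image_linearMap, ENNReal.toReal_mul,
    LinearMap.det_toLpLin, ENNReal.toReal_ofReal (abs_nonneg _), ← hdet, Real.sqrt_sq_eq_abs,
    Measure.real]

lemma vol_shift (D : EuclideanSpace ℝ (Fin 3)) (S : Set (EuclideanSpace ℝ (Fin 3))) :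
    volume.real ((fun p => p - D) ⁻¹' S) = volume.real S := by
  rw [Measure.real, Measure.real]
  congr 1
  simp_rw [sub_eq_add_neg]
  exact measure_preimage_add_right volume (-D) S

def sec (A B C D : EuclideanSpace ℝ (Fin 3)) (ρ : ℝ) : Set (EuclideanSpace ℝ (Fin 3)) :=
  (fun p => p - D) ⁻¹' (closedBall 0 ρ ∩ cone3 (A - D) (B - D) (C - D))

lemma sec_upper (A B C D : EuclideanSpace ℝ (Fin 3)) (ρ : ℝ) :
    tetra A B C D ∩ closedBall D ρ ⊆ sec A B C D ρ := by
  rintro p ⟨hp, hb⟩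
  rw [tetra_mem] at hp
  obtain ⟨x, y, z, hx, hy, hz, hs, e⟩ := hp
  refine ⟨?_, x, y, z, hx, hy, hz, e⟩
  rw [mem_closedBall_zero_iff]
  rwa [mem_closedBall, dist_eq_norm] at hb

lemma sec_lower (A B C D : EuclideanSpace ℝ (Fin 3)) (ρ : ℝ) (hρ : 0 < ρ)
    (hin : ∀ x y z : ℝ, 0 ≤ x → 0 ≤ y → 0 ≤ z → ρ ^ 2 * (x + y + z) ^ 2 ≤
      ‖x • (A - D) + y • (B - D) + z • (C - D)‖ ^ 2) :
    sec A B C D ρ ⊆ tetra A B C D := by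
  rintro p ⟨hb, x, y, z, hx, hy, hz, e⟩
  rw [tetra_mem]
  refine ⟨x, y, z, hx, hy, hz, ?_, e⟩
  have h1 := hin x y z hx hy hz
  change p - D = _ at e
  rw [← e] at h1
  rw [mem_closedBall_zero_iff] at hb
  have h2 : ‖p - D‖ ^ 2 ≤ ρ ^ 2 := pow_le_pow_left₀ (norm_nonneg _) hb 2
  by_contra hcon
  push Not at hcon
  have : 1 < (x + y + z) ^ 2 := by nlinarith
  have : ρ ^ 2 * 1 < ρ ^ 2 * (x + y + z) ^ 2 := by
    apply mul_lt_mul_of_pos_left this; positivity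
  linarith

lemma sec_meas {A B C D : EuclideanSpace ℝ (Fin 3)} (h : Ind (A - D) (B - D) (C - D)) (ρ : ℝ) :
    MeasurableSet (sec A B C D ρ) := by
  unfold sec
  apply (measurable_id.sub_const D)
  apply measurableSet_closedBall.inter
  rw [cone3_eq h]
  have hH : ∀ n : EuclideanSpace ℝ (Fin 3), MeasurableSet {x | 0 ≤ inner ℝ n x} := fun n =>
    measurableSet_le (by fun_prop) (by fun_prop)
  exact (hH _).inter ((hH _).inter (hH _))

lemma sec_open (A B C D : EuclideanSpace ℝ (Fin 3)) (ρ : ℝ) :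
    volume.real (sec A B C D ρ) = volume.real (sec A B C D ρ ∩ ball D ρ) := by
  apply measureReal_congr
  have h0 : volume (sphere D ρ) = 0 := Measure.addHaar_sphere volume D ρ
  have h1 : ∀ᵐ x, x ∉ sphere D ρ := by
    exact compl_mem_ae_iff.2 h0
  filter_upwards [h1] with x hx
  apply propext
  constructor
  · intro hs
    refine ⟨hs, ?_⟩
    have := hs.1
    rw [mem_closedBall_zero_iff] at this
    rw [mem_ball, dist_eq_norm]
    apply lt_of_le_of_ne this
    intro e
    apply hx
    rw [mem_sphere, dist_eq_norm]; exact e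
  · intro hs; exact hs.1

lemma sec_fin (A B C D : EuclideanSpace ℝ (Fin 3)) (ρ : ℝ) :
    volume (sec A B C D ρ) ≠ ⊤ := by
  apply ne_top_of_le_ne_top (measure_closedBall_lt_top (μ := volume) (x := D) (r := ρ)).ne
  apply measure_mono
  intro p hp
  rw [mem_closedBall, dist_eq_norm]
  have := hp.1
  rwa [mem_closedBall_zero_iff] at this

noncomputable def dE (pq pr ps qr qs rs : ℝ) : ℝ :=
  dih pq pr ps ((pq + pr - qr) / 2) ((pq + ps - qs) / 2) ((pr + ps - rs) / 2)

lemma dE_swap (pq pr ps qr qs rs : ℝ) : dE pq pr ps qr qs rs = dE pq qr qs pr ps rs := by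
  unfold dE dih
  congr 2
  · ring
  · congr 2 <;> ring

lemma dE_swap' (pq pr ps qr qs rs : ℝ) : dE pq pr ps qr qs rs = dE pq ps pr qs qr rs := by
  unfold dE dih
  rw [mul_comm (Real.sqrt _)]
  congr 2
  ring

lemma inner_dist (P Q R : EuclideanSpace ℝ (Fin 3)) :
    inner ℝ (Q - P) (R - P) = (dist P Q ^ 2 + dist P R ^ 2 - dist Q R ^ 2) / 2 := by
  have h : Q - R = (Q - P) - (R - P) := by abel
  rw [dist_comm P Q, dist_comm P R, dist_eq_norm, dist_eq_norm, dist_eq_norm, h,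
    norm_sub_sq_real (Q - P) (R - P)]
  ring

lemma inner_dist' (P Q : EuclideanSpace ℝ (Fin 3)) :
    inner ℝ (Q - P) (Q - P) = dist P Q ^ 2 := by
  rw [inner_dist]; simp

lemma sec_vol {P Q R S : EuclideanSpace ℝ (Fin 3)} (h : Ind (Q - P) (R - P) (S - P)) (ρ : ℝ)
    (hρ : 0 ≤ ρ) :
    volume.real (sec Q R S P ρ) = 1 / 3 * ρ ^ 3 *
    (dE (dist P Q ^ 2) (dist P R ^ 2) (dist P S ^ 2) (dist Q R ^ 2) (dist Q S ^ 2) (dist R S ^ 2) +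
     dE (dist P R ^ 2) (dist P Q ^ 2) (dist P S ^ 2) (dist Q R ^ 2) (dist R S ^ 2) (dist Q S ^ 2) +
     dE (dist P S ^ 2) (dist P Q ^ 2) (dist P R ^ 2) (dist Q S ^ 2) (dist R S ^ 2) (dist Q R ^ 2)
     - Real.pi) := by
  rw [sec, vol_shift, sector h ρ hρ]
  rw [dE_swap' (dist P R ^ 2)]
  simp only [dE]
  rw [inner_dist', inner_dist', inner_dist', inner_dist, inner_dist, inner_dist, inner_dist,
    inner_dist, inner_dist, dist_comm R Q, dist_comm S Q, dist_comm S R]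

-- Part Geo2

noncomputable def SS (ρ ab ac bc ad bd cd : ℝ) : ℝ :=
  1 / 3 * (2 * (dE ab ac ad bc bd cd + dE ac ab ad bc cd bd + dE bc ab bd ac cd ad) +
    (1 + ρ ^ 3) * (dE ad ab ac bd cd bc + dE bd ab bc ad cd ac + dE cd ac bc ad bd ab)
    - (3 + ρ ^ 3) * Real.pi)

noncomputable def Gd (ab ac bc ad bd cd : ℝ) : ℝ :=
  gdet ad bd cd ((ad + bd - ab) / 2) ((ad + cd - ac) / 2) ((bd + cd - bc) / 2)

lemma sum_sec {A B C D : EuclideanSpace ℝ (Fin 3)} (h : AffineIndependent ℝ ![A, B, C, D])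
    (ρ : ℝ) (hρ : 0 ≤ ρ) :
    volume.real (sec B C D A 1) + volume.real (sec C D A B 1) + volume.real (sec D A B C 1) +
      volume.real (sec A B C D ρ) = SS ρ (dist A B ^ 2) (dist A C ^ 2) (dist B C ^ 2)
        (dist A D ^ 2) (dist B D ^ 2) (dist C D ^ 2) := by
  have hD := Ind_of h
  have hA := Ind_perm hD
  have hB := Ind_perm hA
  have hC := Ind_perm hB
  rw [sec_vol hA 1 zero_le_one, sec_vol hB 1 zero_le_one, sec_vol hC 1 zero_le_one, sec_vol hD ρ hρ]
  rw [dist_comm B A, dist_comm C A, dist_comm C B, dist_comm D A, dist_comm D B, dist_comm D C]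
  generalize dist A B ^ 2 = ab
  generalize dist A C ^ 2 = ac
  generalize dist B C ^ 2 = bc
  generalize dist A D ^ 2 = ad
  generalize dist B D ^ 2 = bd
  generalize dist C D ^ 2 = cd
  unfold SS
  rw [dE_swap bc cd ac bd ab ad, dE_swap' bc bd ab cd ac ad, dE_swap' bd bc ab cd ad ac,
    dE_swap ab bc bd ac ad cd, dE_swap ac cd bc ad ab bd, dE_swap' ac ad ab cd bc bd,
    dE_swap ad bd cd ab ac bc, dE_swap bd ad cd ab bc ac, dE_swap cd ad bd ac bc ab]
  ring

lemma upper_T {A B C D : EuclideanSpace ℝ (Fin 3)} (h : AffineIndependent ℝ ![A, B, C, D])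
    (ρ : ℝ) (hρ : 0 ≤ ρ) :
    volume.real (tetra A B C D ∩
    (closedBall A 1 ∪ closedBall B 1 ∪ closedBall C 1 ∪ closedBall D ρ)) ≤
     SS ρ (dist A B ^ 2) (dist A C ^ 2) (dist B C ^ 2)
        (dist A D ^ 2) (dist B D ^ 2) (dist C D ^ 2) := by
  rw [← sum_sec h ρ hρ]
  have uA := sec_upper B C D A 1
  have uB := sec_upper C D A B 1
  have uC := sec_upper D A B C 1
  have uD := sec_upper A B C D ρ
  rw [tetra_perm] at uA
  rw [tetra_perm, tetra_perm] at uB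
  rw [← tetra_perm] at uC
  have hsub : tetra A B C D ∩
    (closedBall A 1 ∪ closedBall B 1 ∪ closedBall C 1 ∪ closedBall D ρ) ⊆
     sec B C D A 1 ∪ sec C D A B 1 ∪ sec D A B C 1 ∪ sec A B C D ρ := by
    rintro p ⟨hT, ((hp | hp) | hp) | hp⟩
    · exact Or.inl (Or.inl (Or.inl (uA ⟨hT, hp⟩)))
    · exact Or.inl (Or.inl (Or.inr (uB ⟨hT, hp⟩)))
    · exact Or.inl (Or.inr (uC ⟨hT, hp⟩))
    · exact Or.inr (uD ⟨hT, hp⟩)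
  have f1 := sec_fin B C D A 1
  have f2 := sec_fin C D A B 1
  have f3 := sec_fin D A B C 1
  have f4 := sec_fin A B C D ρ
  refine (measureReal_mono hsub (by simp [*])).trans ?_
  refine (measureReal_union_le _ _).trans ?_
  gcongr
  refine (measureReal_union_le _ _).trans ?_
  gcongr
  exact measureReal_union_le _ _

lemma disj_sec {A B C D A' B' C' D' : EuclideanSpace ℝ (Fin 3)} {ρ ρ' : ℝ}
    (h : ρ + ρ' ≤ dist D D') :
    Disjoint (sec A B C D ρ ∩ ball D ρ) (sec A' B' C' D' ρ' ∩ ball D' ρ') :=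
  (ball_disjoint_ball h).mono Set.inter_subset_right Set.inter_subset_right

lemma lower_T {A B C D : EuclideanSpace ℝ (Fin 3)} (h : AffineIndependent ℝ ![A, B, C, D])
    (ρ : ℝ) (hρ : 0 < ρ) (dAB : 2 ≤ dist A B) (dAC : 2 ≤ dist A C) (dBC : 2 ≤ dist B C)
    (dAD : 1 + ρ ≤ dist A D) (dBD : 1 + ρ ≤ dist B D) (dCD : 1 + ρ ≤ dist C D)
    (hA : sec B C D A 1 ⊆ tetra B C D A) (hB : sec C D A B 1 ⊆ tetra C D A B)
    (hC : sec D A B C 1 ⊆ tetra D A B C) (hD : sec A B C D ρ ⊆ tetra A B C D) :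
    SS ρ (dist A B ^ 2) (dist A C ^ 2) (dist B C ^ 2)
        (dist A D ^ 2) (dist B D ^ 2) (dist C D ^ 2) ≤
    volume.real (tetra A B C D ∩
    (closedBall A 1 ∪ closedBall B 1 ∪ closedBall C 1 ∪ closedBall D ρ)) := by
  rw [← sum_sec h ρ hρ.le]
  rw [tetra_perm] at hA
  rw [tetra_perm, tetra_perm] at hB
  rw [← tetra_perm] at hC
  have iD := Ind_of h
  have iA := Ind_perm iD
  have iB := Ind_perm iA
  have iC := Ind_perm iB
  rw [sec_open, sec_open C, sec_open D, sec_open A]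
  have f1 := sec_fin B C D A 1
  have f2 := sec_fin C D A B 1
  have f3 := sec_fin D A B C 1
  have f4 := sec_fin A B C D ρ
  have g1 := measure_ne_top_of_subset (Set.inter_subset_left (t := ball A 1)) f1
  have g2 := measure_ne_top_of_subset (Set.inter_subset_left (t := ball B 1)) f2
  have g3 := measure_ne_top_of_subset (Set.inter_subset_left (t := ball C 1)) f3
  have g4 := measure_ne_top_of_subset (Set.inter_subset_left (t := ball D ρ)) f4
  have m2 := (sec_meas iB 1).inter (measurableSet_ball (x := B) (ε := 1))
  have m3 := (sec_meas iC 1).inter (measurableSet_ball (x := C) (ε := 1))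
  have m4 := (sec_meas iD ρ).inter (measurableSet_ball (x := D) (ε := ρ))
  rw [← measureReal_union (disj_sec (by linarith)) m2 g1 g2]
  rw [← measureReal_union _ m3 (by simp [*]) g3]
  · rw [← measureReal_union _ m4 (by simp [*]) g4]
    · apply measureReal_mono
      · have key : ∀ {S T : Set (EuclideanSpace ℝ (Fin 3))} {X : EuclideanSpace ℝ (Fin 3)} {s : ℝ},
          S ⊆ T → S ∩ ball X s ⊆ T ∩ closedBall X s := fun hST =>
            Set.inter_subset_inter hST ball_subset_closedBall
        rintro p (((hp | hp) | hp) | hp)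
        · exact ⟨(key hA hp).1, Or.inl (Or.inl (Or.inl (key hA hp).2))⟩
        · exact ⟨(key hB hp).1, Or.inl (Or.inl (Or.inr (key hB hp).2))⟩
        · exact ⟨(key hC hp).1, Or.inl (Or.inr (key hC hp).2)⟩
        · exact ⟨(key hD hp).1, Or.inr (key hD hp).2⟩
      · refine measure_ne_top_of_subset Set.inter_subset_right ?_
        have := fun (X : EuclideanSpace ℝ (Fin 3)) (s : ℝ) =>
          (measure_closedBall_lt_top (μ := volume) (x := X) (r := s)).ne
        exact measure_union_ne_top (measure_union_ne_top (measure_union_ne_top (this _ _) (this _ _))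
          (this _ _)) (this _ _)
    · refine Disjoint.union_left (Disjoint.union_left ?_ ?_) ?_ <;>
      exact disj_sec (by linarith)
  · refine Disjoint.union_left ?_ ?_ <;> exact disj_sec (by linarith)

lemma vol_T (A B C D : EuclideanSpace ℝ (Fin 3)) :
    volume.real (tetra A B C D) = Real.sqrt (Gd (dist A B ^ 2) (dist A C ^ 2) (dist B C ^ 2)
        (dist A D ^ 2) (dist B D ^ 2) (dist C D ^ 2)) *
      volume.real {p : EuclideanSpace ℝ (Fin 3) | 0 ≤ p 0 ∧ 0 ≤ p 1 ∧ 0 ≤ p 2 ∧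
        p 0 + p 1 + p 2 ≤ 1} := by
  have e : tetra A B C D = (fun p => p - D) ⁻¹' simp3 (A - D) (B - D) (C - D) := by
    ext p; exact tetra_mem A B C D p
  rw [e, vol_shift, vol_simp3, inner_dist', inner_dist', inner_dist', inner_dist, inner_dist,
    inner_dist, dist_comm D A, dist_comm D B, dist_comm D C, Gd]

lemma Gd_pos {A B C D : EuclideanSpace ℝ (Fin 3)} (h : AffineIndependent ℝ ![A, B, C, D]) :
    0 < Gd (dist A B ^ 2) (dist A C ^ 2) (dist B C ^ 2)
        (dist A D ^ 2) (dist B D ^ 2) (dist C D ^ 2) := by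
  have := gdet_pos (Ind_of h)
  rwa [inner_dist', inner_dist', inner_dist', inner_dist, inner_dist,
    inner_dist, dist_comm D A, dist_comm D B, dist_comm D C] at this

lemma dens_le {A B C D A₀ B₀ C₀ D₀ : EuclideanSpace ℝ (Fin 3)}
    (h : AffineIndependent ℝ ![A, B, C, D]) (h₀ : AffineIndependent ℝ ![A₀, B₀, C₀, D₀])
    {ρ s s₀ : ℝ}
    (hs : volume.real (tetra A B C D ∩
      (closedBall A 1 ∪ closedBall B 1 ∪ closedBall C 1 ∪ closedBall D ρ)) ≤ s)
    (hs₀ : s₀ ≤ volume.real (tetra A₀ B₀ C₀ D₀ ∩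
      (closedBall A₀ 1 ∪ closedBall B₀ 1 ∪ closedBall C₀ 1 ∪ closedBall D₀ ρ)))
    (hcomp : s / Real.sqrt (Gd (dist A B ^ 2) (dist A C ^ 2) (dist B C ^ 2)
        (dist A D ^ 2) (dist B D ^ 2) (dist C D ^ 2)) ≤
      s₀ / Real.sqrt (Gd (dist A₀ B₀ ^ 2) (dist A₀ C₀ ^ 2) (dist B₀ C₀ ^ 2)
        (dist A₀ D₀ ^ 2) (dist B₀ D₀ ^ 2) (dist C₀ D₀ ^ 2))) :
    density A B C D 1 1 1 ρ ≤ density A₀ B₀ C₀ D₀ 1 1 1 ρ := by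
  have v1 := vol_T A B C D
  have v2 := vol_T A₀ B₀ C₀ D₀
  have p1 := Real.sqrt_pos.2 (Gd_pos h)
  have p2 := Real.sqrt_pos.2 (Gd_pos h₀)
  unfold density
  change volume.real _ / volume.real _ ≤ volume.real _ / volume.real _
  rw [v1, v2]
  set κ := volume.real {p : EuclideanSpace ℝ (Fin 3) | 0 ≤ p 0 ∧ 0 ≤ p 1 ∧ 0 ≤ p 2 ∧
        p 0 + p 1 + p 2 ≤ 1}
  have hκ : 0 ≤ κ := measureReal_nonneg
  rw [← div_div, ← div_div]
  apply div_le_div_of_nonneg_right _ hκ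
  calc _ ≤ _ := div_le_div_of_nonneg_right hs p1.le
    _ ≤ _ := hcomp
    _ ≤ _ := div_le_div_of_nonneg_right hs₀ p2.le

-- Part Dih

noncomputable def NN (pq pr ps qr qs rs : ℝ) : ℝ :=
  ((pr + ps - rs) / 2) * pq - ((pq + pr - qr) / 2) * ((pq + ps - qs) / 2)

noncomputable def PP (pq pr qr : ℝ) : ℝ := pq * pr - ((pq + pr - qr) / 2) ^ 2

lemma dE_eq (pq pr ps qr qs rs : ℝ) : dE pq pr ps qr qs rs =
    Real.arccos (NN pq pr ps qr qs rs / (Real.sqrt (PP pq pr qr) * Real.sqrt (PP pq ps qs))) := rfl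

/-- Gram determinant seen from vertex `P`. -/
noncomputable def GP (pq pr ps qr qs rs : ℝ) : ℝ :=
  gdet pq pr ps ((pq + pr - qr) / 2) ((pq + ps - qs) / 2) ((pr + ps - rs) / 2)

lemma PPNN (pq pr ps qr qs rs : ℝ) :
    PP pq pr qr * PP pq ps qs - NN pq pr ps qr qs rs ^ 2 = pq * GP pq pr ps qr qs rs := by
  unfold PP NN GP gdet; ring

lemma arccos_deriv {N P Q : ℝ → ℝ} {N' P' Q' t K : ℝ} (hN : HasDerivAt N N' t)
    (hP : HasDerivAt P P' t) (hQ : HasDerivAt Q Q' t) (p : 0 < P t) (q : 0 < Q t)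
    (hK : P t * Q t - N t ^ 2 = K ^ 2) (k : 0 < K) :
    HasDerivAt (fun s => Real.arccos (N s / (Real.sqrt (P s) * Real.sqrt (Q s))))
      ((N t * (P' / P t + Q' / Q t) - 2 * N') / (2 * K)) t := by
  have sp := Real.sqrt_pos.2 p
  have sq := Real.sqrt_pos.2 q
  have ep := Real.sq_sqrt p.le
  have eq := Real.sq_sqrt q.le
  have h1 := (hN.div ((hP.sqrt p.ne').mul (hQ.sqrt q.ne')) (mul_ne_zero sp.ne' sq.ne'))
  set f := fun s => N s / (Real.sqrt (P s) * Real.sqrt (Q s)) with hf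
  have hft : f t ^ 2 = N t ^ 2 / (P t * Q t) := by
    rw [hf]; simp only; rw [div_pow, mul_pow, ep, eq]
  have hlt : f t ^ 2 < 1 := by
    rw [hft, div_lt_one (by positivity)]
    nlinarith [sq_pos_of_pos k]
  have hne1 : f t ≠ -1 := by intro h; rw [h] at hlt; norm_num at hlt
  have hne2 : f t ≠ 1 := by intro h; rw [h] at hlt; norm_num at hlt
  have hs : Real.sqrt (1 - f t ^ 2) = K / (Real.sqrt (P t) * Real.sqrt (Q t)) := by
    rw [hft, Real.sqrt_eq_iff_mul_self_eq_of_pos (by positivity)]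
    rw [div_mul_div_comm, ← pow_two, ← hK, ← pow_two, mul_pow, ep, eq]
    field_simp
  have h2 := (Real.hasDerivAt_arccos hne1 hne2).comp t h1
  refine h2.congr_deriv ?_
  rw [hs]
  simp only [Pi.mul_apply]
  set a := Real.sqrt (P t)
  set b := Real.sqrt (Q t)
  rw [← ep, ← eq]
  field_simp
  ring

lemma dE_deriv {pq pr ps qr qs rs : ℝ → ℝ} {a b c d e f t : ℝ} (h1 : HasDerivAt pq a t)
    (h2 : HasDerivAt pr b t) (h3 : HasDerivAt ps c t) (h4 : HasDerivAt qr d t)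
    (h5 : HasDerivAt qs e t) (h6 : HasDerivAt rs f t) (p : 0 < PP (pq t) (pr t) (qr t))
    (q : 0 < PP (pq t) (ps t) (qs t)) (hpq : 0 < pq t) {Δ : ℝ} (hΔ : 0 < Δ)
    (hG : GP (pq t) (pr t) (ps t) (qr t) (qs t) (rs t) = Δ) :
    HasDerivAt (fun s => dE (pq s) (pr s) (ps s) (qr s) (qs s) (rs s))
      (((pq t * f - rs t * a)
        - NN (qr t) (pq t) (qs t) (pr t) (rs t) (ps t) / PP (pq t) (pr t) (qr t) *
          (pq t * b - pr t * a)
        - NN (pr t) (pq t) (ps t) (qr t) (rs t) (qs t) / PP (pq t) (pr t) (qr t) *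
          (pq t * d - qr t * a)
        - NN (qs t) (pq t) (qr t) (ps t) (rs t) (pr t) / PP (pq t) (ps t) (qs t) *
          (pq t * c - ps t * a)
        - NN (ps t) (pq t) (pr t) (qs t) (rs t) (qr t) / PP (pq t) (ps t) (qs t) *
          (pq t * e - qs t * a)) / (2 * Real.sqrt (pq t) * Real.sqrt Δ)) t := by
  have hK : PP (pq t) (pr t) (qr t) * PP (pq t) (ps t) (qs t) -
      NN (pq t) (pr t) (ps t) (qr t) (qs t) (rs t) ^ 2 = (Real.sqrt (pq t) * Real.sqrt Δ) ^ 2 := by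
    rw [PPNN, mul_pow, Real.sq_sqrt hpq.le, Real.sq_sqrt hΔ.le, hG]
  have hP : HasDerivAt (fun s => PP (pq s) (pr s) (qr s))
      (a * pr t + pq t * b - (pq t + pr t - qr t) / 2 * (a + b - d)) t := by
    unfold PP
    refine ((h1.mul h2).sub ((((h1.add h2).sub h4).div_const 2).pow 2)).congr_deriv ?_
    simp only [Pi.add_apply, Pi.sub_apply]
    push_cast; ring
  have hQ : HasDerivAt (fun s => PP (pq s) (ps s) (qs s))
      (a * ps t + pq t * c - (pq t + ps t - qs t) / 2 * (a + c - e)) t := by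
    unfold PP
    refine ((h1.mul h3).sub ((((h1.add h3).sub h5).div_const 2).pow 2)).congr_deriv ?_
    simp only [Pi.add_apply, Pi.sub_apply]
    push_cast; ring
  have hN : HasDerivAt (fun s => NN (pq s) (pr s) (ps s) (qr s) (qs s) (rs s))
      ((b + c - f) / 2 * pq t + (pr t + ps t - rs t) / 2 * a - ((a + b - d) / 2 *
        ((pq t + ps t - qs t) / 2) + (pq t + pr t - qr t) / 2 * ((a + c - e) / 2))) t := by
    unfold NN
    exact ((((h2.add h3).sub h6).div_const 2).mul h1).sub
      ((((h1.add h2).sub h4).div_const 2).mul (((h1.add h3).sub h5).div_const 2))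
  have key := arccos_deriv hN hP hQ p q hK (by positivity)
  refine (key.congr_deriv ?_)
  rw [← mul_assoc]
  congr 1
  have p' := p.ne'
  have q' := q.ne'
  field_simp
  unfold NN PP
  ring

lemma Gd_deriv {ab ac bc ad bd cd : ℝ → ℝ} {a b c d e f t : ℝ} (h1 : HasDerivAt ab a t)
    (h2 : HasDerivAt ac b t) (h3 : HasDerivAt bc c t) (h4 : HasDerivAt ad d t)
    (h5 : HasDerivAt bd e t) (h6 : HasDerivAt cd f t) :
    HasDerivAt (fun s => Gd (ab s) (ac s) (bc s) (ad s) (bd s) (cd s))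
      (NN (cd t) (ac t) (bc t) (ad t) (bd t) (ab t) * a +
       NN (bd t) (ab t) (bc t) (ad t) (cd t) (ac t) * b +
       NN (ad t) (ab t) (ac t) (bd t) (cd t) (bc t) * c +
       NN (bc t) (ab t) (bd t) (ac t) (cd t) (ad t) * d +
       NN (ac t) (ab t) (ad t) (bc t) (cd t) (bd t) * e +
       NN (ab t) (ac t) (ad t) (bc t) (bd t) (cd t) * f) t := by
  unfold Gd gdet
  have x := ((h4.add h5).sub h1).div_const 2
  have y := ((h4.add h6).sub h2).div_const 2
  have z := ((h5.add h6).sub h3).div_const 2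
  refine ((((((h4.mul h5).mul h6).add (((x.const_mul 2).mul y).mul z)).sub (h4.mul (z.pow 2))).sub
    (h5.mul (y.pow 2))).sub (h6.mul (x.pow 2))).congr_deriv ?_
  simp only [Pi.add_apply, Pi.sub_apply, Pi.mul_apply, Pi.pow_apply]
  unfold NN
  push_cast
  ring

-- Part Box

lemma mulb {x y : ℝ} (x0 y0 a b c r : ℝ) (hx : |x - x0| ≤ a) (hy : |y - y0| ≤ b)
    (h : |x0 * y0 - c| + a * |y0| + |x0| * b + a * b ≤ r) : |x * y - c| ≤ r := by
  have e : x * y - c = (x - x0) * y0 + x0 * (y - y0) + (x - x0) * (y - y0) + (x0 * y0 - c) := by ring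
  have ha : 0 ≤ a := (abs_nonneg _).trans hx
  have h1 : |(x - x0) * y0| ≤ a * |y0| := by
    rw [abs_mul]; exact mul_le_mul_of_nonneg_right hx (abs_nonneg _)
  have h2 : |x0 * (y - y0)| ≤ |x0| * b := by
    rw [abs_mul]; exact mul_le_mul_of_nonneg_left hy (abs_nonneg _)
  have h3 : |(x - x0) * (y - y0)| ≤ a * b := by
    rw [abs_mul]; exact mul_le_mul hx hy (abs_nonneg _) ha
  rw [e]
  have a1 := abs_add_le ((x - x0) * y0 + x0 * (y - y0) + (x - x0) * (y - y0)) (x0 * y0 - c)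
  have a2 := abs_add_le ((x - x0) * y0 + x0 * (y - y0)) ((x - x0) * (y - y0))
  have a3 := abs_add_le ((x - x0) * y0) (x0 * (y - y0))
  linarith

lemma invb {x : ℝ} (x0 a c r : ℝ) (hx : |x - x0| ≤ a) (ha : a < x0)
    (h1 : (c - r) * (x0 + a) ≤ 1) (h2 : 1 ≤ (c + r) * (x0 - a)) (h3 : 0 ≤ c - r) :
    |x⁻¹ - c| ≤ r := by
  rw [abs_le] at hx ⊢
  have hp : 0 < x := by linarith
  have h4 : (c - r) * x ≤ 1 := le_trans (mul_le_mul_of_nonneg_left (by linarith) h3) h1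
  have h5 : 1 ≤ (c + r) * x := by
    refine le_trans h2 (mul_le_mul_of_nonneg_left (by linarith) ?_)
    by_contra hc
    push Not at hc
    nlinarith
  rw [← one_div]
  constructor
  · have := (le_div_iff₀ hp).2 h4
    linarith
  · have := (div_le_iff₀ hp).2 h5
    linarith

structure Box (ab ac bc ad bd cd : ℝ) : Prop where
  ab : |ab - 7.25| ≤ 0.013
  ac : |ac - 4.0045| ≤ 0.0045
  bc : |bc - 4.0045| ≤ 0.0045
  ad : |ad - 2.0032| ≤ 0.0032
  bd : |bd - 2.0032| ≤ 0.0032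
  cd : |cd - 2.0032| ≤ 0.0032

lemma Box.swap {ab ac bc ad bd cd : ℝ} (h : Box ab ac bc ad bd cd) : Box ab bc ac bd ad cd :=
  ⟨h.ab, h.bc, h.ac, h.bd, h.ad, h.cd⟩

lemma linb {x y z : ℝ} (x0 y0 z0 a b c w r : ℝ) (hx : |x - x0| ≤ a) (hy : |y - y0| ≤ b)
    (hz : |z - z0| ≤ c) (hw : (x0 + y0 - z0) / 2 = w) (hr : (a + b + c) / 2 = r) :
    |(x + y - z) / 2 - w| ≤ r := by
  rw [abs_le] at *
  subst hw hr
  constructor <;> linarith [hx.1, hx.2, hy.1, hy.2, hz.1, hz.2]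

lemma subb {x y : ℝ} (x0 y0 a b w r : ℝ) (hx : |x - x0| ≤ a) (hy : |y - y0| ≤ b)
    (h : |x0 - y0 - w| + a + b ≤ r) : |x - y - w| ≤ r := by
  have h1 := neg_abs_le (x0 - y0 - w)
  have h2 := le_abs_self (x0 - y0 - w)
  rw [abs_le] at *
  constructor <;> linarith [hx.1, hx.2, hy.1, hy.2]

lemma bP_ABC {ab ac bc ad bd cd : ℝ} (h : Box ab ac bc ad bd cd) :
    |PP ab ac bc - (15.892)| ≤ 0.0446 := by
  have e : PP ab ac bc = ac * bc - ((ac + bc - ab) / 2) * ((ac + bc - ab) / 2) := by unfold PP; ring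
  have l := linb _ _ _ _ _ _ _ _ h.ac h.bc h.ab rfl rfl
  have p1 := mulb _ _ _ _ (16.036) 0.0361 h.ac h.bc (by norm_num)
  have p2 := mulb _ _ _ _ (0.144) 0.0085 l l (by norm_num)
  rw [e]
  exact subb _ _ _ _ _ _ p1 p2 (by norm_num)

lemma bP_ABD {ab ac bc ad bd cd : ℝ} (h : Box ab ac bc ad bd cd) :
    |PP ab ad bd - (1.3826)| ≤ 0.0445 := by
  have e : PP ab ad bd = ad * bd - ((ad + bd - ab) / 2) * ((ad + bd - ab) / 2) := by unfold PP; ring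
  have l := linb _ _ _ _ _ _ _ _ h.ad h.bd h.ab rfl rfl
  have p1 := mulb _ _ _ _ (4.0128) 0.0129 h.ad h.bd (by norm_num)
  have p2 := mulb _ _ _ _ (2.6302) 0.0316 l l (by norm_num)
  rw [e]
  exact subb _ _ _ _ _ _ p1 p2 (by norm_num)

lemma bP_ACD {ab ac bc ad bd cd : ℝ} (h : Box ab ac bc ad bd cd) :
    |PP ac ad cd - (4.0128)| ≤ 0.013 := by
  have e : PP ac ad cd = ad * cd - ((ad + cd - ac) / 2) * ((ad + cd - ac) / 2) := by unfold PP; ring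
  have l := linb _ _ _ _ _ _ _ _ h.ad h.cd h.ac rfl rfl
  have p1 := mulb _ _ _ _ (4.0128) 0.0129 h.ad h.cd (by norm_num)
  have p2 := mulb _ _ _ _ (0.0) 0.0001 l l (by norm_num)
  rw [e]
  exact subb _ _ _ _ _ _ p1 p2 (by norm_num)

lemma bN_AB {ab ac bc ad bd cd : ℝ} (h : Box ab ac bc ad bd cd) :
    |NN ab ac ad bc bd cd - (1.3757)| ≤ 0.1409 := by
  have e : NN ab ac ad bc bd cd = ((ac + ad - cd) / 2) * ab - ((ab + ac - bc) / 2) * ((ab + ad - bd) / 2) := by unfold NN; ring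
  have l1 := linb _ _ _ _ _ _ _ _ h.ac h.ad h.cd rfl rfl
  have l2 := linb _ _ _ _ _ _ _ _ h.ab h.ac h.bc rfl rfl
  have l3 := linb _ _ _ _ _ _ _ _ h.ab h.ad h.bd rfl rfl
  have p1 := mulb _ _ _ _ (14.5163) 0.0657 l1 h.ab (by norm_num)
  have p2 := mulb _ _ _ _ (13.1406) 0.0752 l2 l3 (by norm_num)
  rw [e]
  exact subb _ _ _ _ _ _ p1 p2 (by norm_num)

lemma bN_AC {ab ac bc ad bd cd : ℝ} (h : Box ab ac bc ad bd cd) :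
    |NN ac ab ad bc cd bd - (7.2581)| ≤ 0.0551 := by
  have e : NN ac ab ad bc cd bd = ((bc + cd - bd) / 2) * ac - ((ac + bc - ab) / 2) * ((ac + cd - ad) / 2) := by unfold NN; ring
  have l1 := linb _ _ _ _ _ _ _ _ h.bc h.cd h.bd rfl rfl
  have l2 := linb _ _ _ _ _ _ _ _ h.ac h.bc h.ab rfl rfl
  have l3 := linb _ _ _ _ _ _ _ _ h.ac h.cd h.ad rfl rfl
  have p1 := mulb _ _ _ _ (8.018) 0.0309 l1 h.ac (by norm_num)
  have p2 := mulb _ _ _ _ (0.7599) 0.0242 l2 l3 (by norm_num)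
  rw [e]
  exact subb _ _ _ _ _ _ p1 p2 (by norm_num)

lemma bN_AD {ab ac bc ad bd cd : ℝ} (h : Box ab ac bc ad bd cd) :
    |NN ad ab ac bd cd bc - (0.0034)| ≤ 0.02 := by
  have e : NN ad ab ac bd cd bc = ((bd + cd - bc) / 2) * ad - ((ad + bd - ab) / 2) * ((ad + cd - ac) / 2) := by unfold NN; ring
  have l1 := linb _ _ _ _ _ _ _ _ h.bd h.cd h.bc rfl rfl
  have l2 := linb _ _ _ _ _ _ _ _ h.ad h.bd h.ab rfl rfl
  have l3 := linb _ _ _ _ _ _ _ _ h.ad h.cd h.ac rfl rfl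
  have p1 := mulb _ _ _ _ (0.0019) 0.011 l1 h.ad (by norm_num)
  have p2 := mulb _ _ _ _ (-0.0015) 0.009 l2 l3 (by norm_num)
  rw [e]
  exact subb _ _ _ _ _ _ p1 p2 (by norm_num)

lemma bN_CD {ab ac bc ad bd cd : ℝ} (h : Box ab ac bc ad bd cd) :
    |NN cd ac bc ad bd ab - (-3.2488)| ≤ 0.0248 := by
  have e : NN cd ac bc ad bd ab = ((ad + bd - ab) / 2) * cd - ((cd + ad - ac) / 2) * ((cd + bd - bc) / 2) := by unfold NN; ring
  have l1 := linb _ _ _ _ _ _ _ _ h.ad h.bd h.ab rfl rfl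
  have l2 := linb _ _ _ _ _ _ _ _ h.cd h.ad h.ac rfl rfl
  have l3 := linb _ _ _ _ _ _ _ _ h.cd h.bd h.bc rfl rfl
  have p1 := mulb _ _ _ _ (-3.2488) 0.0247 l1 h.cd (by norm_num)
  have p2 := mulb _ _ _ _ (0.0) 0.0001 l2 l3 (by norm_num)
  rw [e]
  exact subb _ _ _ _ _ _ p1 p2 (by norm_num)

-- Part Psi

noncomputable def mm (we wf le lf : ℝ) : ℝ := we * le - wf * le ^ 2 / lf

lemma bq1 {n p : ℝ} (hn : |n - 7.2581| ≤ 0.0551) (hp : |p - 15.892| ≤ 0.0446) :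
    |n / p - 0.4568| ≤ 0.005 := by
  have i := invb _ _ 0.06293 0.00019 hp (by norm_num) (by norm_num) (by norm_num) (by norm_num)
  rw [div_eq_mul_inv]
  exact mulb _ _ _ _ _ _ hn i (by norm_num)

lemma bq2 {n p : ℝ} (hn : |n - 1.3757| ≤ 0.1409) (hp : |p - 15.892| ≤ 0.0446) :
    |n / p - 0.0866| ≤ 0.0092 := by
  have i := invb _ _ 0.06293 0.00019 hp (by norm_num) (by norm_num) (by norm_num) (by norm_num)
  rw [div_eq_mul_inv]
  exact mulb _ _ _ _ _ _ hn i (by norm_num)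

lemma bq3 {n p : ℝ} (hn : |n - 0.0034| ≤ 0.02) (hp : |p - 1.3826| ≤ 0.0445) :
    |n / p - 0.0025| ≤ 0.0151 := by
  have i := invb _ _ 0.72403 0.02331 hp (by norm_num) (by norm_num) (by norm_num) (by norm_num)
  rw [div_eq_mul_inv]
  exact mulb _ _ _ _ _ _ hn i (by norm_num)

lemma bq4 {n p : ℝ} (hn : |n - 1.3757| ≤ 0.1409) (hp : |p - 1.3826| ≤ 0.0445) :
    |n / p - 0.996| ≤ 0.1375 := by
  have i := invb _ _ 0.72403 0.02331 hp (by norm_num) (by norm_num) (by norm_num) (by norm_num)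
  rw [div_eq_mul_inv]
  exact mulb _ _ _ _ _ _ hn i (by norm_num)

lemma bq5 {n p : ℝ} (hn : |n - (-3.2488)| ≤ 0.0248) (hp : |p - 4.0128| ≤ 0.013) :
    |n / p - (-0.8096)| ≤ 0.0089 := by
  have i := invb _ _ 0.24921 0.00082 hp (by norm_num) (by norm_num) (by norm_num) (by norm_num)
  rw [div_eq_mul_inv]
  exact mulb _ _ _ _ _ _ hn i (by norm_num)

lemma bq6 {n p : ℝ} (hn : |n - 0.0034| ≤ 0.02) (hp : |p - 4.0128| ≤ 0.013) :
    |n / p - 0.0008| ≤ 0.0051 := by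
  have i := invb _ _ 0.24921 0.00082 hp (by norm_num) (by norm_num) (by norm_num) (by norm_num)
  rw [div_eq_mul_inv]
  exact mulb _ _ _ _ _ _ hn i (by norm_num)

lemma bq7 {n p : ℝ} (hn : |n - 7.2581| ≤ 0.0551) (hp : |p - 4.0128| ≤ 0.013) :
    |n / p - 1.8088| ≤ 0.0198 := by
  have i := invb _ _ 0.24921 0.00082 hp (by norm_num) (by norm_num) (by norm_num) (by norm_num)
  rw [div_eq_mul_inv]
  exact mulb _ _ _ _ _ _ hn i (by norm_num)

lemma bmLT {we wf le lf : ℝ} (h1 : |we - 2| ≤ 0)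
    (h2 : |wf - 2| ≤ 0) (h3 : |le - 2.6926| ≤ 0.0026)
    (h4 : |lf - 2.0012| ≤ 0.0012) : |mm we wf le lf - (-1.8606)| ≤ 0.0242 := by
  have i := invb _ _ 0.4997 0.00031 h4 (by norm_num) (by norm_num) (by norm_num) (by norm_num)
  have s := mulb _ _ _ _ 7.2501 0.0141 h3 h3 (by norm_num)
  have si := mulb _ _ _ _ 3.6229 0.0094 s i (by norm_num)
  have w := mulb _ _ _ _ 7.2458 0.0189 h2 si (by norm_num)
  have v := mulb _ _ _ _ 5.3852 0.0053 h1 h3 (by norm_num)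
  have e : mm we wf le lf = we * le - wf * (le * le * lf⁻¹) := by
    unfold mm; rw [div_eq_mul_inv]; ring
  rw [e]
  exact subb _ _ _ _ _ _ v w (by norm_num)

lemma bmLD {we wf le lf : ℝ} (h1 : |we - 2| ≤ 0)
    (h2 : |wf - 1.07107| ≤ 0.00001) (h3 : |le - 2.6926| ≤ 0.0026)
    (h4 : |lf - 1.4153| ≤ 0.0012) : |mm we wf le lf - (-0.1015)| ≤ 0.021 := by
  have i := invb _ _ 0.70656 0.00061 h4 (by norm_num) (by norm_num) (by norm_num) (by norm_num)
  have s := mulb _ _ _ _ 7.2501 0.0141 h3 h3 (by norm_num)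
  have si := mulb _ _ _ _ 5.1226 0.0145 s i (by norm_num)
  have w := mulb _ _ _ _ 5.4867 0.0157 h2 si (by norm_num)
  have v := mulb _ _ _ _ 5.3852 0.0053 h1 h3 (by norm_num)
  have e : mm we wf le lf = we * le - wf * (le * le * lf⁻¹) := by
    unfold mm; rw [div_eq_mul_inv]; ring
  rw [e]
  exact subb _ _ _ _ _ _ v w (by norm_num)

lemma bmTL {we wf le lf : ℝ} (h1 : |we - 2| ≤ 0)
    (h2 : |wf - 2| ≤ 0) (h3 : |le - 2.0012| ≤ 0.0012)
    (h4 : |lf - 2.6926| ≤ 0.0026) : |mm we wf le lf - 1.0278| ≤ 0.0094 := by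
  have i := invb _ _ 0.37139 0.00037 h4 (by norm_num) (by norm_num) (by norm_num) (by norm_num)
  have s := mulb _ _ _ _ 4.0048 0.0049 h3 h3 (by norm_num)
  have si := mulb _ _ _ _ 1.4873 0.0034 s i (by norm_num)
  have w := mulb _ _ _ _ 2.9746 0.0069 h2 si (by norm_num)
  have v := mulb _ _ _ _ 4.0024 0.0025 h1 h3 (by norm_num)
  have e : mm we wf le lf = we * le - wf * (le * le * lf⁻¹) := by
    unfold mm; rw [div_eq_mul_inv]; ring
  rw [e]
  exact subb _ _ _ _ _ _ v w (by norm_num)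

lemma bmTT {we wf le lf : ℝ} (h1 : |we - 2| ≤ 0)
    (h2 : |wf - 2| ≤ 0) (h3 : |le - 2.0012| ≤ 0.0012)
    (h4 : |lf - 2.0012| ≤ 0.0012) : |mm we wf le lf - 0| ≤ 0.01 := by
  have i := invb _ _ 0.4997 0.00031 h4 (by norm_num) (by norm_num) (by norm_num) (by norm_num)
  have s := mulb _ _ _ _ 4.0048 0.0049 h3 h3 (by norm_num)
  have si := mulb _ _ _ _ 2.0012 0.0037 s i (by norm_num)
  have w := mulb _ _ _ _ 4.0024 0.0075 h2 si (by norm_num)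
  have v := mulb _ _ _ _ 4.0024 0.0025 h1 h3 (by norm_num)
  have e : mm we wf le lf = we * le - wf * (le * le * lf⁻¹) := by
    unfold mm; rw [div_eq_mul_inv]; ring
  rw [e]
  exact subb _ _ _ _ _ _ v w (by norm_num)

lemma bmTD {we wf le lf : ℝ} (h1 : |we - 2| ≤ 0)
    (h2 : |wf - 1.07107| ≤ 0.00001) (h3 : |le - 2.0012| ≤ 0.0012)
    (h4 : |lf - 1.4153| ≤ 0.0012) : |mm we wf le lf - 0.9717| ≤ 0.009 := by
  have i := invb _ _ 0.70656 0.00061 h4 (by norm_num) (by norm_num) (by norm_num) (by norm_num)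
  have s := mulb _ _ _ _ 4.0048 0.0049 h3 h3 (by norm_num)
  have si := mulb _ _ _ _ 2.8296 0.006 s i (by norm_num)
  have w := mulb _ _ _ _ 3.0307 0.0065 h2 si (by norm_num)
  have v := mulb _ _ _ _ 4.0024 0.0025 h1 h3 (by norm_num)
  have e : mm we wf le lf = we * le - wf * (le * le * lf⁻¹) := by
    unfold mm; rw [div_eq_mul_inv]; ring
  rw [e]
  exact subb _ _ _ _ _ _ v w (by norm_num)

lemma bmDL {we wf le lf : ℝ} (h1 : |we - 1.07107| ≤ 0.00001)
    (h2 : |wf - 2| ≤ 0) (h3 : |le - 1.4153| ≤ 0.0012)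
    (h4 : |lf - 2.6926| ≤ 0.0026) : |mm we wf le lf - 0.0281| ≤ 0.0057 := by
  have i := invb _ _ 0.37139 0.00037 h4 (by norm_num) (by norm_num) (by norm_num) (by norm_num)
  have s := mulb _ _ _ _ 2.0031 0.0035 h3 h3 (by norm_num)
  have si := mulb _ _ _ _ 0.7439 0.0021 s i (by norm_num)
  have w := mulb _ _ _ _ 1.4878 0.0043 h2 si (by norm_num)
  have v := mulb _ _ _ _ 1.5159 0.0014 h1 h3 (by norm_num)
  have e : mm we wf le lf = we * le - wf * (le * le * lf⁻¹) := by
    unfold mm; rw [div_eq_mul_inv]; ring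
  rw [e]
  exact subb _ _ _ _ _ _ v w (by norm_num)

lemma bmDT {we wf le lf : ℝ} (h1 : |we - 1.07107| ≤ 0.00001)
    (h2 : |wf - 2| ≤ 0) (h3 : |le - 1.4153| ≤ 0.0012)
    (h4 : |lf - 2.0012| ≤ 0.0012) : |mm we wf le lf - (-0.4859)| ≤ 0.0065 := by
  have i := invb _ _ 0.4997 0.00031 h4 (by norm_num) (by norm_num) (by norm_num) (by norm_num)
  have s := mulb _ _ _ _ 2.0031 0.0035 h3 h3 (by norm_num)
  have si := mulb _ _ _ _ 1.0009 0.0025 s i (by norm_num)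
  have w := mulb _ _ _ _ 2.0018 0.0051 h2 si (by norm_num)
  have v := mulb _ _ _ _ 1.5159 0.0014 h1 h3 (by norm_num)
  have e : mm we wf le lf = we * le - wf * (le * le * lf⁻¹) := by
    unfold mm; rw [div_eq_mul_inv]; ring
  rw [e]
  exact subb _ _ _ _ _ _ v w (by norm_num)

lemma bmDD {we wf le lf : ℝ} (h1 : |we - 1.07107| ≤ 0.00001)
    (h2 : |wf - 1.07107| ≤ 0.00001) (h3 : |le - 1.4153| ≤ 0.0012)
    (h4 : |lf - 1.4153| ≤ 0.0012) : |mm we wf le lf - 0| ≤ 0.0055 := by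
  have i := invb _ _ 0.70656 0.00061 h4 (by norm_num) (by norm_num) (by norm_num) (by norm_num)
  have s := mulb _ _ _ _ 2.0031 0.0035 h3 h3 (by norm_num)
  have si := mulb _ _ _ _ 1.4153 0.0038 s i (by norm_num)
  have w := mulb _ _ _ _ 1.5159 0.0041 h2 si (by norm_num)
  have v := mulb _ _ _ _ 1.5159 0.0014 h1 h3 (by norm_num)
  have e : mm we wf le lf = we * le - wf * (le * le * lf⁻¹) := by
    unfold mm; rw [div_eq_mul_inv]; ring
  rw [e]
  exact subb _ _ _ _ _ _ v w (by norm_num)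

lemma hAB {k n q1 q2 q3 q4 m1 m2 m3 m4 m5 : ℝ}
    (hk : |k - 0.1354| ≤ 0.0036) (hn : |n - (-3.2488)| ≤ 0.0248)
    (hq1 : |q1 - 0.4568| ≤ 0.005) (hm1 : |m1 - 1.0278| ≤ 0.0094)
    (hq2 : |q2 - 0.4568| ≤ 0.005) (hm2 : |m2 - 1.0278| ≤ 0.0094)
    (hq3 : |q3 - 0.0025| ≤ 0.0151) (hm3 : |m3 - 0.0281| ≤ 0.0057)
    (hq4 : |q4 - 0.0025| ≤ 0.0151) (hm4 : |m4 - 0.0281| ≤ 0.0057)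
    (hm5 : |m5 - 0.0281| ≤ 0.0057) :
    -0.49 ≤ 3 * (k * n) + q1 * m1 + q2 * m2 + q3 * m3 + q4 * m4 - m5 ∧ 3 * (k * n) + q1 * m1 + q2 * m2 + q3 * m3 + q4 * m4 - m5 ≤ -0.33 := by
  have a0 := mulb _ _ _ _ (-0.4399) 0.0152 hk hn (by norm_num)
  have a1 := mulb _ _ _ _ 0.4695 0.0095 hq1 hm1 (by norm_num)
  have a2 := mulb _ _ _ _ 0.4695 0.0095 hq2 hm2 (by norm_num)
  have a3 := mulb _ _ _ _ 0.0001 0.0006 hq3 hm3 (by norm_num)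
  have a4 := mulb _ _ _ _ 0.0001 0.0006 hq4 hm4 (by norm_num)
  rw [abs_le] at a0 a1 a2 a3 a4 hm5
  constructor <;> linarith [a0.1, a0.2, a1.1, a1.2, a2.1, a2.2, a3.1, a3.2, a4.1, a4.2, hm5.1, hm5.2]

lemma hAC {k n q1 q2 q3 q4 m1 m2 m3 m4 m5 : ℝ}
    (hk : |k - 0.1354| ≤ 0.0036) (hn : |n - 0.0034| ≤ 0.02)
    (hq1 : |q1 - 0.4568| ≤ 0.005) (hm1 : |m1 - (-1.8606)| ≤ 0.0242)
    (hq2 : |q2 - 0.0866| ≤ 0.0092) (hm2 : |m2 - 0| ≤ 0.01)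
    (hq3 : |q3 - (-0.8096)| ≤ 0.0089) (hm3 : |m3 - (-0.4859)| ≤ 0.0065)
    (hq4 : |q4 - 0.0008| ≤ 0.0051) (hm4 : |m4 - (-0.4859)| ≤ 0.0065)
    (hm5 : |m5 - (-0.4859)| ≤ 0.0065) :
    -0.02 ≤ 3 * (k * n) + q1 * m1 + q2 * m2 + q3 * m3 + q4 * m4 - m5 := by
  have a0 := mulb _ _ _ _ 0.0005 0.0029 hk hn (by norm_num)
  have a1 := mulb _ _ _ _ (-0.8499) 0.0206 hq1 hm1 (by norm_num)
  have a2 := mulb _ _ _ _ 0 0.001 hq2 hm2 (by norm_num)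
  have a3 := mulb _ _ _ _ 0.3934 0.0097 hq3 hm3 (by norm_num)
  have a4 := mulb _ _ _ _ (-0.0004) 0.0026 hq4 hm4 (by norm_num)
  rw [abs_le] at a0 a1 a2 a3 a4 hm5
  linarith [a0.1, a0.2, a1.1, a1.2, a2.1, a2.2, a3.1, a3.2, a4.1, a4.2, hm5.1, hm5.2]

lemma hAD {k n q1 q2 q3 q4 m1 m2 m3 m4 m5 : ℝ}
    (hk : |k - 0.1354| ≤ 0.0036) (hn : |n - 7.2581| ≤ 0.0551)
    (hq1 : |q1 - 0.0025| ≤ 0.0151) (hm1 : |m1 - (-0.1015)| ≤ 0.021)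
    (hq2 : |q2 - 0.996| ≤ 0.1375) (hm2 : |m2 - 0| ≤ 0.0055)
    (hq3 : |q3 - (-0.8096)| ≤ 0.0089) (hm3 : |m3 - 0.9717| ≤ 0.009)
    (hq4 : |q4 - 1.8088| ≤ 0.0198) (hm4 : |m4 - 0| ≤ 0.0055)
    (hm5 : |m5 - 0.9717| ≤ 0.009) :
    1.02 ≤ 3 * (k * n) + q1 * m1 + q2 * m2 + q3 * m3 + q4 * m4 - m5 := by
  have a0 := mulb _ _ _ _ 0.9827 0.0339 hk hn (by norm_num)
  have a1 := mulb _ _ _ _ (-0.0003) 0.002 hq1 hm1 (by norm_num)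
  have a2 := mulb _ _ _ _ 0 0.0063 hq2 hm2 (by norm_num)
  have a3 := mulb _ _ _ _ (-0.7867) 0.0161 hq3 hm3 (by norm_num)
  have a4 := mulb _ _ _ _ 0 0.0101 hq4 hm4 (by norm_num)
  rw [abs_le] at a0 a1 a2 a3 a4 hm5
  linarith [a0.1, a0.2, a1.1, a1.2, a2.1, a2.2, a3.1, a3.2, a4.1, a4.2, hm5.1, hm5.2]

lemma hCD {k n q1 q2 q3 q4 m1 m2 m3 m4 m5 : ℝ}
    (hk : |k - 0.1354| ≤ 0.0036) (hn : |n - 1.3757| ≤ 0.1409)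
    (hq1 : |q1 - 0.0008| ≤ 0.0051) (hm1 : |m1 - 0.9717| ≤ 0.009)
    (hq2 : |q2 - 1.8088| ≤ 0.0198) (hm2 : |m2 - 0| ≤ 0.0055)
    (hq3 : |q3 - 0.0008| ≤ 0.0051) (hm3 : |m3 - 0.9717| ≤ 0.009)
    (hq4 : |q4 - 1.8088| ≤ 0.0198) (hm4 : |m4 - 0| ≤ 0.0055)
    (hm5 : |m5 - (-0.1015)| ≤ 0.021) :
    0.52 ≤ 3 * (k * n) + q1 * m1 + q2 * m2 + q3 * m3 + q4 * m4 - m5 := by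
  have a0 := mulb _ _ _ _ 0.1863 0.0246 hk hn (by norm_num)
  have a1 := mulb _ _ _ _ 0.0008 0.0051 hq1 hm1 (by norm_num)
  have a2 := mulb _ _ _ _ 0 0.0101 hq2 hm2 (by norm_num)
  have a3 := mulb _ _ _ _ 0.0008 0.0051 hq3 hm3 (by norm_num)
  have a4 := mulb _ _ _ _ 0 0.0101 hq4 hm4 (by norm_num)
  rw [abs_le] at a0 a1 a2 a3 a4 hm5
  linarith [a0.1, a0.2, a1.1, a1.2, a2.1, a2.2, a3.1, a3.2, a4.1, a4.2, hm5.1, hm5.2]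

-- Part Mono

lemma dE_deriv2 {pq pr ps qr qs rs : ℝ → ℝ} {a b c d e f t : ℝ} (h1 : HasDerivAt pq a t)
    (h2 : HasDerivAt pr b t) (h3 : HasDerivAt ps c t) (h4 : HasDerivAt qr d t)
    (h5 : HasDerivAt qs e t) (h6 : HasDerivAt rs f t) {Δ n1 n2 n3 n4 P Q : ℝ} (p : 0 < P)
    (q : 0 < Q) (hpq : 0 < pq t)  (hΔ : 0 < Δ)
    (hP : PP (pq t) (pr t) (qr t) = P) (hQ : PP (pq t) (ps t) (qs t) = Q)
    (hn1 : NN (qr t) (pq t) (qs t) (pr t) (rs t) (ps t) = n1)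
    (hn2 : NN (pr t) (pq t) (ps t) (qr t) (rs t) (qs t) = n2)
    (hn3 : NN (qs t) (pq t) (qr t) (ps t) (rs t) (pr t) = n3)
    (hn4 : NN (ps t) (pq t) (pr t) (qs t) (rs t) (qr t) = n4)
    (hG : GP (pq t) (pr t) (ps t) (qr t) (qs t) (rs t) = Δ) :
    HasDerivAt (fun s => dE (pq s) (pr s) (ps s) (qr s) (qs s) (rs s))
      (((pq t * f - rs t * a) - n1 / P * (pq t * b - pr t * a) - n2 / P * (pq t * d - qr t * a)
        - n3 / Q * (pq t * c - ps t * a) - n4 / Q * (pq t * e - qs t * a)) /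
        (2 * Real.sqrt (pq t) * Real.sqrt Δ)) t := by
  subst hP hQ hn1 hn2 hn3 hn4
  exact dE_deriv h1 h2 h3 h4 h5 h6 p q hpq hΔ hG

lemma mm_eq {we wf le lf v u : ℝ} (h1 : 0 < le) (h2 : 0 < lf) (hv : v = we / le) (hu : u = wf / lf) :
    mm we wf le lf = (v - u) * le ^ 2 := by
  subst hv hu; unfold mm; field_simp

lemma psi_id (k w nAB nAC nBC nAD nBD nCD pABC pABD pACD pBCD dAB dAC dBC dAD dBD dCD lAB lAC lBC lAD lBD lCD : ℝ)
    (hAB : 0 < lAB)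
    (hAC : 0 < lAC)
    (hBC : 0 < lBC)
    (hAD : 0 < lAD)
    (hBD : 0 < lBD)
    (hCD : 0 < lCD)
    : 3 * k * (nCD * dAB + nBD * dAC + nAD * dBC + nBC * dAD + nAC * dBD + nAB * dCD) - (
      2 / lAB * ((lAB ^ 2 * dCD - lCD ^ 2 * dAB) - nBC / pABC * (lAB ^ 2 * dAC - lAC ^ 2 * dAB) - nAC / pABC * (lAB ^ 2 * dBC - lBC ^ 2 * dAB) - nBD / pABD * (lAB ^ 2 * dAD - lAD ^ 2 * dAB) - nAD / pABD * (lAB ^ 2 * dBD - lBD ^ 2 * dAB))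
      + 2 / lAC * ((lAC ^ 2 * dBD - lBD ^ 2 * dAC) - nBC / pABC * (lAC ^ 2 * dAB - lAB ^ 2 * dAC) - nAB / pABC * (lAC ^ 2 * dBC - lBC ^ 2 * dAC) - nCD / pACD * (lAC ^ 2 * dAD - lAD ^ 2 * dAC) - nAD / pACD * (lAC ^ 2 * dCD - lCD ^ 2 * dAC))
      + 2 / lBC * ((lBC ^ 2 * dAD - lAD ^ 2 * dBC) - nAC / pABC * (lBC ^ 2 * dAB - lAB ^ 2 * dBC) - nAB / pABC * (lBC ^ 2 * dAC - lAC ^ 2 * dBC) - nCD / pBCD * (lBC ^ 2 * dBD - lBD ^ 2 * dBC) - nBD / pBCD * (lBC ^ 2 * dCD - lCD ^ 2 * dBC))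
      + w / lAD * ((lAD ^ 2 * dBC - lBC ^ 2 * dAD) - nBD / pABD * (lAD ^ 2 * dAB - lAB ^ 2 * dAD) - nAB / pABD * (lAD ^ 2 * dBD - lBD ^ 2 * dAD) - nCD / pACD * (lAD ^ 2 * dAC - lAC ^ 2 * dAD) - nAC / pACD * (lAD ^ 2 * dCD - lCD ^ 2 * dAD))
      + w / lBD * ((lBD ^ 2 * dAC - lAC ^ 2 * dBD) - nAD / pABD * (lBD ^ 2 * dAB - lAB ^ 2 * dBD) - nAB / pABD * (lBD ^ 2 * dAD - lAD ^ 2 * dBD) - nCD / pBCD * (lBD ^ 2 * dBC - lBC ^ 2 * dBD) - nBC / pBCD * (lBD ^ 2 * dCD - lCD ^ 2 * dBD))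
      + w / lCD * ((lCD ^ 2 * dAB - lAB ^ 2 * dCD) - nAD / pACD * (lCD ^ 2 * dAC - lAC ^ 2 * dCD) - nAC / pACD * (lCD ^ 2 * dAD - lAD ^ 2 * dCD) - nBD / pBCD * (lCD ^ 2 * dBC - lBC ^ 2 * dCD) - nBC / pBCD * (lCD ^ 2 * dBD - lBD ^ 2 * dCD))) =
      (3 * (k * nCD) + nBC / pABC * mm 2 2 lAC lAB + nAC / pABC * mm 2 2 lBC lAB + nBD / pABD * mm w 2 lAD lAB + nAD / pABD * mm w 2 lBD lAB - mm w 2 lCD lAB) * dAB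
      + (3 * (k * nBD) + nBC / pABC * mm 2 2 lAB lAC + nAB / pABC * mm 2 2 lBC lAC + nCD / pACD * mm w 2 lAD lAC + nAD / pACD * mm w 2 lCD lAC - mm w 2 lBD lAC) * dAC
      + (3 * (k * nAD) + nAC / pABC * mm 2 2 lAB lBC + nAB / pABC * mm 2 2 lAC lBC + nCD / pBCD * mm w 2 lBD lBC + nBD / pBCD * mm w 2 lCD lBC - mm w 2 lAD lBC) * dBC
      + (3 * (k * nBC) + nBD / pABD * mm 2 w lAB lAD + nAB / pABD * mm w w lBD lAD + nCD / pACD * mm 2 w lAC lAD + nAC / pACD * mm w w lCD lAD - mm 2 w lBC lAD) * dAD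
      + (3 * (k * nAC) + nAD / pABD * mm 2 w lAB lBD + nAB / pABD * mm w w lAD lBD + nCD / pBCD * mm 2 w lBC lBD + nBC / pBCD * mm w w lCD lBD - mm 2 w lAC lBD) * dBD
      + (3 * (k * nAB) + nAD / pACD * mm 2 w lAC lCD + nAC / pACD * mm w w lAD lCD + nBD / pBCD * mm 2 w lBC lCD + nBC / pBCD * mm w w lBD lCD - mm 2 w lAB lCD) * dCD := by
  obtain ⟨vAB, hvAB⟩ : ∃ v, v = 2 / lAB := ⟨_, rfl⟩
  obtain ⟨vAC, hvAC⟩ : ∃ v, v = 2 / lAC := ⟨_, rfl⟩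
  obtain ⟨vBC, hvBC⟩ : ∃ v, v = 2 / lBC := ⟨_, rfl⟩
  obtain ⟨vAD, hvAD⟩ : ∃ v, v = w / lAD := ⟨_, rfl⟩
  obtain ⟨vBD, hvBD⟩ : ∃ v, v = w / lBD := ⟨_, rfl⟩
  obtain ⟨vCD, hvCD⟩ : ∃ v, v = w / lCD := ⟨_, rfl⟩
  rw [mm_eq hAC hAB hvAC hvAB, mm_eq hBC hAB hvBC hvAB, mm_eq hAD hAB hvAD hvAB, mm_eq hBD hAB hvBD hvAB, mm_eq hCD hAB hvCD hvAB]
  rw [mm_eq hAB hAC hvAB hvAC, mm_eq hBC hAC hvBC hvAC, mm_eq hAD hAC hvAD hvAC, mm_eq hCD hAC hvCD hvAC, mm_eq hBD hAC hvBD hvAC]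
  rw [mm_eq hAB hBC hvAB hvBC, mm_eq hAC hBC hvAC hvBC, mm_eq hBD hBC hvBD hvBC, mm_eq hCD hBC hvCD hvBC, mm_eq hAD hBC hvAD hvBC]
  rw [mm_eq hAB hAD hvAB hvAD, mm_eq hBD hAD hvBD hvAD, mm_eq hAC hAD hvAC hvAD, mm_eq hCD hAD hvCD hvAD, mm_eq hBC hAD hvBC hvAD]
  rw [mm_eq hAB hBD hvAB hvBD, mm_eq hAD hBD hvAD hvBD, mm_eq hBC hBD hvBC hvBD, mm_eq hCD hBD hvCD hvBD, mm_eq hAC hBD hvAC hvBD]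
  rw [mm_eq hAC hCD hvAC hvCD, mm_eq hAD hCD hvAD hvCD, mm_eq hBC hCD hvBC hvCD, mm_eq hBD hCD hvBD hvCD, mm_eq hAB hCD hvAB hvCD]
  rw [← hvAB, ← hvAC, ← hvBC, ← hvAD, ← hvBD, ← hvCD]
  ring

lemma psi_nonneg {k w nAB nAC nBC nAD nBD nCD pABC pABD pACD pBCD dAB dAC dBC dAD dBD dCD lAB lAC lBC lAD lBD lCD : ℝ}
    (hk : |k - 0.1354| ≤ 0.0036) (hw : |w - 1.07107| ≤ 0.00001)
    (hnAB : |nAB - 1.3757| ≤ 0.1409) (hlAB : |lAB - 2.6926| ≤ 0.0026)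
    (hnAC : |nAC - 7.2581| ≤ 0.0551) (hlAC : |lAC - 2.0012| ≤ 0.0012)
    (hnBC : |nBC - 7.2581| ≤ 0.0551) (hlBC : |lBC - 2.0012| ≤ 0.0012)
    (hnAD : |nAD - 0.0034| ≤ 0.02) (hlAD : |lAD - 1.4153| ≤ 0.0012)
    (hnBD : |nBD - 0.0034| ≤ 0.02) (hlBD : |lBD - 1.4153| ≤ 0.0012)
    (hnCD : |nCD - (-3.2488)| ≤ 0.0248) (hlCD : |lCD - 1.4153| ≤ 0.0012)
    (hpABC : |pABC - 15.892| ≤ 0.0446)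
    (hpABD : |pABD - 1.3826| ≤ 0.0445)
    (hpACD : |pACD - 4.0128| ≤ 0.013)
    (hpBCD : |pBCD - 4.0128| ≤ 0.013)
    (hdAC : 0 ≤ dAC)
    (hdBC : 0 ≤ dBC)
    (hdAD : 0 ≤ dAD)
    (hdBD : 0 ≤ dBD)
    (hdCD : 0 ≤ dCD)
    (hd : dAB ≤ -0.1 * (dAC + dBC) + 2 * (dAD + dBD) + dCD) :
    0 ≤ 3 * k * (nCD * dAB + nBD * dAC + nAD * dBC + nBC * dAD + nAC * dBD + nAB * dCD) - (
      2 / lAB * ((lAB ^ 2 * dCD - lCD ^ 2 * dAB) - nBC / pABC * (lAB ^ 2 * dAC - lAC ^ 2 * dAB) - nAC / pABC * (lAB ^ 2 * dBC - lBC ^ 2 * dAB) - nBD / pABD * (lAB ^ 2 * dAD - lAD ^ 2 * dAB) - nAD / pABD * (lAB ^ 2 * dBD - lBD ^ 2 * dAB))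
      + 2 / lAC * ((lAC ^ 2 * dBD - lBD ^ 2 * dAC) - nBC / pABC * (lAC ^ 2 * dAB - lAB ^ 2 * dAC) - nAB / pABC * (lAC ^ 2 * dBC - lBC ^ 2 * dAC) - nCD / pACD * (lAC ^ 2 * dAD - lAD ^ 2 * dAC) - nAD / pACD * (lAC ^ 2 * dCD - lCD ^ 2 * dAC))
      + 2 / lBC * ((lBC ^ 2 * dAD - lAD ^ 2 * dBC) - nAC / pABC * (lBC ^ 2 * dAB - lAB ^ 2 * dBC) - nAB / pABC * (lBC ^ 2 * dAC - lAC ^ 2 * dBC) - nCD / pBCD * (lBC ^ 2 * dBD - lBD ^ 2 * dBC) - nBD / pBCD * (lBC ^ 2 * dCD - lCD ^ 2 * dBC))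
      + w / lAD * ((lAD ^ 2 * dBC - lBC ^ 2 * dAD) - nBD / pABD * (lAD ^ 2 * dAB - lAB ^ 2 * dAD) - nAB / pABD * (lAD ^ 2 * dBD - lBD ^ 2 * dAD) - nCD / pACD * (lAD ^ 2 * dAC - lAC ^ 2 * dAD) - nAC / pACD * (lAD ^ 2 * dCD - lCD ^ 2 * dAD))
      + w / lBD * ((lBD ^ 2 * dAC - lAC ^ 2 * dBD) - nAD / pABD * (lBD ^ 2 * dAB - lAB ^ 2 * dBD) - nAB / pABD * (lBD ^ 2 * dAD - lAD ^ 2 * dBD) - nCD / pBCD * (lBD ^ 2 * dBC - lBC ^ 2 * dBD) - nBC / pBCD * (lBD ^ 2 * dCD - lCD ^ 2 * dBD))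
      + w / lCD * ((lCD ^ 2 * dAB - lAB ^ 2 * dCD) - nAD / pACD * (lCD ^ 2 * dAC - lAC ^ 2 * dCD) - nAC / pACD * (lCD ^ 2 * dAD - lAD ^ 2 * dCD) - nBD / pBCD * (lCD ^ 2 * dBC - lBC ^ 2 * dCD) - nBC / pBCD * (lCD ^ 2 * dBD - lBD ^ 2 * dCD))) := by
  have lAB0 : 0 < lAB := by rw [abs_le] at hlAB; linarith [hlAB.1]
  have lAC0 : 0 < lAC := by rw [abs_le] at hlAC; linarith [hlAC.1]
  have lBC0 : 0 < lBC := by rw [abs_le] at hlBC; linarith [hlBC.1]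
  have lAD0 : 0 < lAD := by rw [abs_le] at hlAD; linarith [hlAD.1]
  have lBD0 : 0 < lBD := by rw [abs_le] at hlBD; linarith [hlBD.1]
  have lCD0 : 0 < lCD := by rw [abs_le] at hlCD; linarith [hlCD.1]
  rw [psi_id k w nAB nAC nBC nAD nBD nCD pABC pABD pACD pBCD dAB dAC dBC dAD dBD dCD lAB lAC lBC lAD lBD lCD lAB0 lAC0 lBC0 lAD0 lBD0 lCD0]
  have w2 : |(2:ℝ) - 2| ≤ 0 := by norm_num
  have HAB := hAB hk hnCD (bq1 hnBC hpABC) (bmTL w2 w2 hlAC hlAB) (bq1 hnAC hpABC) (bmTL w2 w2 hlBC hlAB) (bq3 hnBD hpABD) (bmDL hw w2 hlAD hlAB) (bq3 hnAD hpABD) (bmDL hw w2 hlBD hlAB) (bmDL hw w2 hlCD hlAB)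
  have HAC := hAC hk hnBD (bq1 hnBC hpABC) (bmLT w2 w2 hlAB hlAC) (bq2 hnAB hpABC) (bmTT w2 w2 hlBC hlAC) (bq5 hnCD hpACD) (bmDT hw w2 hlAD hlAC) (bq6 hnAD hpACD) (bmDT hw w2 hlCD hlAC) (bmDT hw w2 hlBD hlAC)
  have HBC := hAC hk hnAD (bq1 hnAC hpABC) (bmLT w2 w2 hlAB hlBC) (bq2 hnAB hpABC) (bmTT w2 w2 hlAC hlBC) (bq5 hnCD hpBCD) (bmDT hw w2 hlBD hlBC) (bq6 hnBD hpBCD) (bmDT hw w2 hlCD hlBC) (bmDT hw w2 hlAD hlBC)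
  have HAD := hAD hk hnBC (bq3 hnBD hpABD) (bmLD w2 hw hlAB hlAD) (bq4 hnAB hpABD) (bmDD hw hw hlBD hlAD) (bq5 hnCD hpACD) (bmTD w2 hw hlAC hlAD) (bq7 hnAC hpACD) (bmDD hw hw hlCD hlAD) (bmTD w2 hw hlBC hlAD)
  have HBD := hAD hk hnAC (bq3 hnAD hpABD) (bmLD w2 hw hlAB hlBD) (bq4 hnAB hpABD) (bmDD hw hw hlAD hlBD) (bq5 hnCD hpBCD) (bmTD w2 hw hlBC hlBD) (bq7 hnBC hpBCD) (bmDD hw hw hlCD hlBD) (bmTD w2 hw hlAC hlBD)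
  have HCD := hCD hk hnAB (bq6 hnAD hpACD) (bmTD w2 hw hlAC hlCD) (bq7 hnAC hpACD) (bmDD hw hw hlAD hlCD) (bq6 hnBD hpBCD) (bmTD w2 hw hlBC hlCD) (bq7 hnBC hpBCD) (bmDD hw hw hlBD hlCD) (bmLD w2 hw hlAB hlCD)
  generalize (3 * (k * nCD) + nBC / pABC * mm 2 2 lAC lAB + nAC / pABC * mm 2 2 lBC lAB + nBD / pABD * mm w 2 lAD lAB + nAD / pABD * mm w 2 lBD lAB - mm w 2 lCD lAB) = hAB at *
  generalize (3 * (k * nBD) + nBC / pABC * mm 2 2 lAB lAC + nAB / pABC * mm 2 2 lBC lAC + nCD / pACD * mm w 2 lAD lAC + nAD / pACD * mm w 2 lCD lAC - mm w 2 lBD lAC) = hAC at *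
  generalize (3 * (k * nAD) + nAC / pABC * mm 2 2 lAB lBC + nAB / pABC * mm 2 2 lAC lBC + nCD / pBCD * mm w 2 lBD lBC + nBD / pBCD * mm w 2 lCD lBC - mm w 2 lAD lBC) = hBC at *
  generalize (3 * (k * nBC) + nBD / pABD * mm 2 w lAB lAD + nAB / pABD * mm w w lBD lAD + nCD / pACD * mm 2 w lAC lAD + nAC / pACD * mm w w lCD lAD - mm 2 w lBC lAD) = hAD at *
  generalize (3 * (k * nAC) + nAD / pABD * mm 2 w lAB lBD + nAB / pABD * mm w w lAD lBD + nCD / pBCD * mm 2 w lBC lBD + nBC / pBCD * mm w w lCD lBD - mm 2 w lAC lBD) = hBD at *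
  generalize (3 * (k * nAB) + nAD / pACD * mm 2 w lAC lCD + nAC / pACD * mm w w lAD lCD + nBD / pBCD * mm 2 w lBC lCD + nBC / pBCD * mm w w lBD lCD - mm 2 w lAB lCD) = hCD at *
  have a1 := mul_nonneg (by linarith [HAB.2] : 0 ≤ -hAB) (sub_nonneg.2 hd)
  have a2 := mul_nonneg (by linarith [HAB.2] : 0 ≤ hAC - 0.1 * hAB) hdAC
  have a3 := mul_nonneg (by linarith [HAB.2] : 0 ≤ hBC - 0.1 * hAB) hdBC
  have a4 := mul_nonneg (by linarith [HAB.1] : 0 ≤ hAD + 2 * hAB) hdAD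
  have a5 := mul_nonneg (by linarith [HAB.1] : 0 ≤ hBD + 2 * hAB) hdBD
  have a6 := mul_nonneg (by linarith [HAB.1] : 0 ≤ hCD + hAB) hdCD
  linarith

lemma sqrtb {x c r : ℝ} (h0 : 0 ≤ c - r) (h1 : (c - r) ^ 2 ≤ x) (h2 : x ≤ (c + r) ^ 2) (hr : 0 ≤ r) :
    |Real.sqrt x - c| ≤ r := by
  have a := Real.le_sqrt_of_sq_le h1
  have b := Real.sqrt_le_iff.2 ⟨by linarith, h2⟩
  rw [abs_le]; constructor <;> linarith

lemma Gd_box {ab ac bc ad bd cd : ℝ} (h : Box ab ac bc ad bd cd) : 0 < Gd ab ac bc ad bd cd := by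
  have e : PP ac ad cd * PP bc bd cd - NN cd ac bc ad bd ab ^ 2 = cd * Gd ab ac bc ad bd cd := by
    unfold PP NN Gd gdet; ring
  have a := abs_le.1 (bP_ACD h)
  have b := abs_le.1 (bP_ACD h.swap)
  have c := abs_le.1 (bN_CD h)
  have d := abs_le.1 h.cd
  have : 0 < cd * Gd ab ac bc ad bd cd := by
    rw [← e]; nlinarith
  exact pos_of_mul_pos_right this (by linarith)

lemma Phi_deriv {ab ac bc ad bd cd : ℝ → ℝ} {k ρ t dAB dAC dBC dAD dBD dCD : ℝ}
    (hAB : HasDerivAt ab dAB t)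
    (hAC : HasDerivAt ac dAC t)
    (hBC : HasDerivAt bc dBC t)
    (hAD : HasDerivAt ad dAD t)
    (hBD : HasDerivAt bd dBD t)
    (hCD : HasDerivAt cd dCD t)
    (hB : Box (ab t) (ac t) (bc t) (ad t) (bd t) (cd t)) (hk : |k - 0.1354| ≤ 0.0036)
    (hw : |(1 + ρ ^ 3) - 1.07107| ≤ 0.00001)
    (hdAC : 0 ≤ dAC)
    (hdBC : 0 ≤ dBC)
    (hdAD : 0 ≤ dAD)
    (hdBD : 0 ≤ dBD)
    (hdCD : 0 ≤ dCD)
    (hd : dAB ≤ -0.1 * (dAC + dBC) + 2 * (dAD + dBD) + dCD) :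
    ∃ y, 0 ≤ y ∧ HasDerivAt (fun s => k * Real.sqrt (Gd (ab s) (ac s) (bc s) (ad s) (bd s) (cd s)) -
      SS ρ (ab s) (ac s) (bc s) (ad s) (bd s) (cd s)) y t := by
  have hG := Gd_box hB
  have sG := Real.sqrt_pos.2 hG
  have bAB := abs_le.1 hB.ab
  have bAC := abs_le.1 hB.ac
  have bBC := abs_le.1 hB.bc
  have bAD := abs_le.1 hB.ad
  have bBD := abs_le.1 hB.bd
  have bCD := abs_le.1 hB.cd
  have lAB : |Real.sqrt (ab t) - 2.6926| ≤ 0.0026 :=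
    sqrtb (by norm_num) (by norm_num; linarith [bAB.1]) (by norm_num; linarith [bAB.2]) (by norm_num)
  have lAC : |Real.sqrt (ac t) - 2.0012| ≤ 0.0012 :=
    sqrtb (by norm_num) (by norm_num; linarith [bAC.1]) (by norm_num; linarith [bAC.2]) (by norm_num)
  have lBC : |Real.sqrt (bc t) - 2.0012| ≤ 0.0012 :=
    sqrtb (by norm_num) (by norm_num; linarith [bBC.1]) (by norm_num; linarith [bBC.2]) (by norm_num)
  have lAD : |Real.sqrt (ad t) - 1.4153| ≤ 0.0012 :=
    sqrtb (by norm_num) (by norm_num; linarith [bAD.1]) (by norm_num; linarith [bAD.2]) (by norm_num)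
  have lBD : |Real.sqrt (bd t) - 1.4153| ≤ 0.0012 :=
    sqrtb (by norm_num) (by norm_num; linarith [bBD.1]) (by norm_num; linarith [bBD.2]) (by norm_num)
  have lCD : |Real.sqrt (cd t) - 1.4153| ≤ 0.0012 :=
    sqrtb (by norm_num) (by norm_num; linarith [bCD.1]) (by norm_num; linarith [bCD.2]) (by norm_num)
  have xAB : 0 < ab t := by linarith [bAB.1]
  have xAC : 0 < ac t := by linarith [bAC.1]
  have xBC : 0 < bc t := by linarith [bBC.1]
  have xAD : 0 < ad t := by linarith [bAD.1]
  have xBD : 0 < bd t := by linarith [bBD.1]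
  have xCD : 0 < cd t := by linarith [bCD.1]
  have nAB := bN_AB hB
  have nAC := bN_AC hB
  have nBC := bN_AC hB.swap
  have nAD := bN_AD hB
  have nBD := bN_AD hB.swap
  have nCD := bN_CD hB
  have pABC := bP_ABC hB
  have pABC0 : 0 < PP (ab t) (ac t) (bc t) := by rw [abs_le] at pABC; linarith [pABC.1]
  have pABD := bP_ABD hB
  have pABD0 : 0 < PP (ab t) (ad t) (bd t) := by rw [abs_le] at pABD; linarith [pABD.1]
  have pACD := bP_ACD hB
  have pACD0 : 0 < PP (ac t) (ad t) (cd t) := by rw [abs_le] at pACD; linarith [pACD.1]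
  have pBCD := bP_ACD hB.swap
  have pBCD0 : 0 < PP (bc t) (bd t) (cd t) := by rw [abs_le] at pBCD; linarith [pBCD.1]
  have DAB := dE_deriv2 hAB hAC hAD hBC hBD hCD pABC0 pABD0 xAB hG
    (by unfold PP; ring) (by unfold PP; ring) (n1 := (NN (bc t) (ab t) (bd t) (ac t) (cd t) (ad t))) (hn1 := by unfold NN; ring) (n2 := (NN (ac t) (ab t) (ad t) (bc t) (cd t) (bd t))) (hn2 := by unfold NN; ring) (n3 := (NN (bd t) (ab t) (bc t) (ad t) (cd t) (ac t))) (hn3 := by unfold NN; ring) (n4 := (NN (ad t) (ab t) (ac t) (bd t) (cd t) (bc t))) (hn4 := by unfold NN; ring)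
    (hG := by unfold GP Gd gdet; ring)
  have DAC := dE_deriv2 hAC hAB hAD hBC hCD hBD pABC0 pACD0 xAC hG
    (by unfold PP; ring) (by unfold PP; ring) (n1 := (NN (bc t) (ab t) (bd t) (ac t) (cd t) (ad t))) (hn1 := by unfold NN; ring) (n2 := (NN (ab t) (ac t) (ad t) (bc t) (bd t) (cd t))) (hn2 := by unfold NN; ring) (n3 := (NN (cd t) (ac t) (bc t) (ad t) (bd t) (ab t))) (hn3 := by unfold NN; ring) (n4 := (NN (ad t) (ab t) (ac t) (bd t) (cd t) (bc t))) (hn4 := by unfold NN; ring)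
    (hG := by unfold GP Gd gdet; ring)
  have DBC := dE_deriv2 hBC hAB hBD hAC hCD hAD pABC0 pBCD0 xBC hG
    (by unfold PP; ring) (by unfold PP; ring) (n1 := (NN (ac t) (ab t) (ad t) (bc t) (cd t) (bd t))) (hn1 := by unfold NN; ring) (n2 := (NN (ab t) (ac t) (ad t) (bc t) (bd t) (cd t))) (hn2 := by unfold NN; ring) (n3 := (NN (cd t) (ac t) (bc t) (ad t) (bd t) (ab t))) (hn3 := by unfold NN; ring) (n4 := (NN (bd t) (ab t) (bc t) (ad t) (cd t) (ac t))) (hn4 := by unfold NN; ring)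
    (hG := by unfold GP Gd gdet; ring)
  have DAD := dE_deriv2 hAD hAB hAC hBD hCD hBC pABD0 pACD0 xAD hG
    (by unfold PP; ring) (by unfold PP; ring) (n1 := (NN (bd t) (ab t) (bc t) (ad t) (cd t) (ac t))) (hn1 := by unfold NN; ring) (n2 := (NN (ab t) (ac t) (ad t) (bc t) (bd t) (cd t))) (hn2 := by unfold NN; ring) (n3 := (NN (cd t) (ac t) (bc t) (ad t) (bd t) (ab t))) (hn3 := by unfold NN; ring) (n4 := (NN (ac t) (ab t) (ad t) (bc t) (cd t) (bd t))) (hn4 := by unfold NN; ring)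
    (hG := by unfold GP Gd gdet; ring)
  have DBD := dE_deriv2 hBD hAB hBC hAD hCD hAC pABD0 pBCD0 xBD hG
    (by unfold PP; ring) (by unfold PP; ring) (n1 := (NN (ad t) (ab t) (ac t) (bd t) (cd t) (bc t))) (hn1 := by unfold NN; ring) (n2 := (NN (ab t) (ac t) (ad t) (bc t) (bd t) (cd t))) (hn2 := by unfold NN; ring) (n3 := (NN (cd t) (ac t) (bc t) (ad t) (bd t) (ab t))) (hn3 := by unfold NN; ring) (n4 := (NN (bc t) (ab t) (bd t) (ac t) (cd t) (ad t))) (hn4 := by unfold NN; ring)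
    (hG := by unfold GP Gd gdet; ring)
  have DCD := dE_deriv2 hCD hAC hBC hAD hBD hAB pACD0 pBCD0 xCD hG
    (by unfold PP; ring) (by unfold PP; ring) (n1 := (NN (ad t) (ab t) (ac t) (bd t) (cd t) (bc t))) (hn1 := by unfold NN; ring) (n2 := (NN (ac t) (ab t) (ad t) (bc t) (cd t) (bd t))) (hn2 := by unfold NN; ring) (n3 := (NN (bd t) (ab t) (bc t) (ad t) (cd t) (ac t))) (hn3 := by unfold NN; ring) (n4 := (NN (bc t) (ab t) (bd t) (ac t) (cd t) (ad t))) (hn4 := by unfold NN; ring)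
    (hG := by unfold GP Gd gdet; ring)
  have DG := ((Gd_deriv hAB hAC hBC hAD hBD hCD).sqrt hG.ne').const_mul k
  have DS := ((((DAB.add DAC).add DBC).const_mul 2).add (((DAD.add DBD).add DCD).const_mul (1 + ρ ^ 3))).sub_const ((3 + ρ ^ 3) * Real.pi)
  have DS := DS.const_mul (1 / 3)
  have Y := psi_nonneg hk hw nAB lAB nAC lAC nBC lBC nAD lAD nBD lBD nCD lCD pABC pABD pACD pBCD hdAC hdBC hdAD hdBD hdCD hd
  rw [Real.sq_sqrt xAB.le, Real.sq_sqrt xAC.le, Real.sq_sqrt xBC.le, Real.sq_sqrt xAD.le, Real.sq_sqrt xBD.le, Real.sq_sqrt xCD.le] at Y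
  have G6 : 0 ≤ 1 / (6 * Real.sqrt (Gd (ab t) (ac t) (bc t) (ad t) (bd t) (cd t))) := by positivity
  refine ⟨_, mul_nonneg G6 Y, (DG.sub DS).congr_deriv ?_⟩
  clear Y DS DG DAB DAC DBC DAD DBD DCD
  have sAB := (Real.sqrt_pos.2 xAB).ne'
  generalize Real.sqrt (ab t) = lAB at sAB ⊢
  have sAC := (Real.sqrt_pos.2 xAC).ne'
  generalize Real.sqrt (ac t) = lAC at sAC ⊢
  have sBC := (Real.sqrt_pos.2 xBC).ne'
  generalize Real.sqrt (bc t) = lBC at sBC ⊢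
  have sAD := (Real.sqrt_pos.2 xAD).ne'
  generalize Real.sqrt (ad t) = lAD at sAD ⊢
  have sBD := (Real.sqrt_pos.2 xBD).ne'
  generalize Real.sqrt (bd t) = lBD at sBD ⊢
  have sCD := (Real.sqrt_pos.2 xCD).ne'
  generalize Real.sqrt (cd t) = lCD at sCD ⊢
  generalize (NN (ab t) (ac t) (ad t) (bc t) (bd t) (cd t)) = NAB
  generalize (NN (ac t) (ab t) (ad t) (bc t) (cd t) (bd t)) = NAC
  generalize (NN (bc t) (ab t) (bd t) (ac t) (cd t) (ad t)) = NBC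
  generalize (NN (ad t) (ab t) (ac t) (bd t) (cd t) (bc t)) = NAD
  generalize (NN (bd t) (ab t) (bc t) (ad t) (cd t) (ac t)) = NBD
  generalize (NN (cd t) (ac t) (bc t) (ad t) (bd t) (ab t)) = NCD
  generalize (PP (ab t) (ac t) (bc t)) = PABC
  generalize (PP (ab t) (ad t) (bd t)) = PABD
  generalize (PP (ac t) (ad t) (cd t)) = PACD
  generalize (PP (bc t) (bd t) (cd t)) = PBCD
  have sG := sG.ne'
  generalize Real.sqrt (Gd (ab t) (ac t) (bc t) (ad t) (bd t) (cd t)) = g at sG ⊢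
  generalize NAB / PABC = QABABC
  generalize NAC / PABC = QACABC
  generalize NBC / PABC = QBCABC
  generalize NAB / PABD = QABABD
  generalize NAD / PABD = QADABD
  generalize NBD / PABD = QBDABD
  generalize NAC / PACD = QACACD
  generalize NAD / PACD = QADACD
  generalize NCD / PACD = QCDACD
  generalize NBC / PBCD = QBCBCD
  generalize NBD / PBCD = QBDBCD
  generalize NCD / PBCD = QCDBCD
  field_simp
  ring

-- Part Mono2

lemma segb {x x0 c r t : ℝ} (h : |x - c| ≤ r) (h0 : |x0 - c| ≤ r) (t0 : 0 ≤ t) (t1 : t ≤ 1) :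
    |x0 + t * (x - x0) - c| ≤ r := by
  rw [abs_le] at *
  constructor
  · nlinarith [mul_nonneg t0 (by linarith [h.1] : 0 ≤ x - c + r),
      mul_nonneg (sub_nonneg.2 t1) (by linarith [h0.1] : 0 ≤ x0 - c + r)]
  · nlinarith [mul_nonneg t0 (by linarith [h.2] : 0 ≤ r - (x - c)),
      mul_nonneg (sub_nonneg.2 t1) (by linarith [h0.2] : 0 ≤ r - (x0 - c))]

lemma Box.seg {ab ac bc ad bd cd ab0 ac0 bc0 ad0 bd0 cd0 t : ℝ} (h : Box ab ac bc ad bd cd)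
    (h0 : Box ab0 ac0 bc0 ad0 bd0 cd0) (t0 : 0 ≤ t) (t1 : t ≤ 1) :
    Box (ab0 + t * (ab - ab0)) (ac0 + t * (ac - ac0)) (bc0 + t * (bc - bc0))
      (ad0 + t * (ad - ad0)) (bd0 + t * (bd - bd0)) (cd0 + t * (cd - cd0)) :=
  ⟨segb h.ab h0.ab t0 t1, segb h.ac h0.ac t0 t1, segb h.bc h0.bc t0 t1,
    segb h.ad h0.ad t0 t1, segb h.bd h0.bd t0 t1, segb h.cd h0.cd t0 t1⟩

lemma lind (x0 d t : ℝ) : HasDerivAt (fun s => x0 + s * d) d t := by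
  simpa using ((hasDerivAt_id t).mul_const d).const_add x0

lemma Phi_mono {ab ac bc ad bd cd ab0 ac0 bc0 ad0 bd0 cd0 k ρ : ℝ} (h : Box ab ac bc ad bd cd)
    (h0 : Box ab0 ac0 bc0 ad0 bd0 cd0) (hk : |k - 0.1354| ≤ 0.0036)
    (hw : |(1 + ρ ^ 3) - 1.07107| ≤ 0.00001)
    (hdAC : ac0 ≤ ac) (hdBC : bc0 ≤ bc) (hdAD : ad0 ≤ ad) (hdBD : bd0 ≤ bd) (hdCD : cd0 ≤ cd)
    (hd : ab - ab0 ≤ -0.1 * ((ac - ac0) + (bc - bc0)) + 2 * ((ad - ad0) + (bd - bd0)) + (cd - cd0)) :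
    k * Real.sqrt (Gd ab0 ac0 bc0 ad0 bd0 cd0) - SS ρ ab0 ac0 bc0 ad0 bd0 cd0 ≤
    k * Real.sqrt (Gd ab ac bc ad bd cd) - SS ρ ab ac bc ad bd cd := by
  have key : ∀ t ∈ Set.Icc (0:ℝ) 1, ∃ y, 0 ≤ y ∧ HasDerivAt (fun s =>
      k * Real.sqrt (Gd (ab0 + s * (ab - ab0)) (ac0 + s * (ac - ac0)) (bc0 + s * (bc - bc0))
      (ad0 + s * (ad - ad0)) (bd0 + s * (bd - bd0)) (cd0 + s * (cd - cd0))) -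
      SS ρ (ab0 + s * (ab - ab0)) (ac0 + s * (ac - ac0)) (bc0 + s * (bc - bc0))
      (ad0 + s * (ad - ad0)) (bd0 + s * (bd - bd0)) (cd0 + s * (cd - cd0))) y t := by
    intro t ht
    exact Phi_deriv (lind _ _ t) (lind _ _ t) (lind _ _ t) (lind _ _ t) (lind _ _ t) (lind _ _ t)
      (h.seg h0 ht.1 ht.2) hk hw (sub_nonneg.2 hdAC) (sub_nonneg.2 hdBC) (sub_nonneg.2 hdAD)
      (sub_nonneg.2 hdBD) (sub_nonneg.2 hdCD) hd
  have m := monotoneOn_of_deriv_nonneg (convex_Icc (0:ℝ) 1)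
    (fun t ht => (key t ht).choose_spec.2.continuousAt.continuousWithinAt)
    (fun t ht => (key t (interior_subset ht)).choose_spec.2.differentiableAt.differentiableWithinAt)
    (fun t ht => by
      rw [(key t (interior_subset ht)).choose_spec.2.deriv]
      exact (key t (interior_subset ht)).choose_spec.1)
  have := m (Set.left_mem_Icc.2 zero_le_one) (Set.right_mem_Icc.2 zero_le_one) zero_le_one
  simpa using this

lemma PP_deriv {ab ac bc : ℝ → ℝ} {a b c t : ℝ} (h1 : HasDerivAt ab a t)
    (h2 : HasDerivAt ac b t) (h3 : HasDerivAt bc c t) :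
    HasDerivAt (fun s => PP (ab s) (ac s) (bc s))
      ((ac t + bc t - ab t) / 2 * a + (ab t + bc t - ac t) / 2 * b +
        (ab t + ac t - bc t) / 2 * c) t := by
  unfold PP
  refine ((h1.mul h2).sub ((((h1.add h2).sub h3).div_const 2).pow 2)).congr_deriv ?_
  simp only [Pi.add_apply, Pi.sub_apply]
  push_cast; ring

lemma constr_alg {x1 x2 x3 q n1 n2 n3 n4 n5 n6 d1 d2 d3 d4 d5 d6 : ℝ} (q0 : 0.17 ≤ q) (q1 : q ≤ 0.173)
    (b1 : |x1 - 7.25| ≤ 0.013) (b2 : |x2 - 4.0045| ≤ 0.0045) (b3 : |x3 - 4.0045| ≤ 0.0045)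
    (h1 : |n1 - 1.3757| ≤ 0.1409) (h2 : |n2 - 7.2581| ≤ 0.0551) (h3 : |n3 - 7.2581| ≤ 0.0551)
    (h4 : |n4 - 0.0034| ≤ 0.02) (h5 : |n5 - 0.0034| ≤ 0.02) (h6 : |n6 - (-3.2488)| ≤ 0.0248)
    (k2 : 0 ≤ d2) (k3 : 0 ≤ d3) (k4 : 0 ≤ d4) (k5 : 0 ≤ d5) (k6 : 0 ≤ d6)
    (hc : -0.1 * (d2 + d3) + 2 * (d4 + d5) + d6 < d1) :
    n6 * d1 + n5 * d2 + n4 * d3 + n3 * d4 + n2 * d5 + n1 * d6 -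
      q * ((x2 + x3 - x1) / 2 * d1 + (x1 + x3 - x2) / 2 * d2 + (x1 + x2 - x3) / 2 * d3) -
      (3.5 * d4 + 3.5 * d5 + 0.6 * d6) < 0 := by
  rw [abs_le] at *
  obtain ⟨b1, b1'⟩ := b1
  obtain ⟨b2, b2'⟩ := b2
  obtain ⟨b3, b3'⟩ := b3
  have c1 : 0 ≤ q * ((x2 + x3 - x1) / 2) := mul_nonneg (by linarith) (by linarith)
  have c2 : 0.6 ≤ q * ((x1 + x3 - x2) / 2) := 
    le_trans (by norm_num) (mul_le_mul q0 (by linarith : 3.6 ≤ ((x1 + x3 - x2) / 2)) (by norm_num) (by linarith))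
  have c3 : 0.6 ≤ q * ((x1 + x2 - x3) / 2) := 
    le_trans (by norm_num) (mul_le_mul q0 (by linarith : 3.6 ≤ ((x1 + x2 - x3) / 2)) (by norm_num) (by linarith))
  have c1' : q * ((x2 + x3 - x1) / 2) ≤ 0.2 :=
    le_trans (mul_le_mul q1 (by linarith : ((x2 + x3 - x1) / 2) ≤ 1) (by linarith) (by norm_num)) (by norm_num)
  have e : n6 * d1 + n5 * d2 + n4 * d3 + n3 * d4 + n2 * d5 + n1 * d6 -
      q * ((x2 + x3 - x1) / 2 * d1 + (x1 + x3 - x2) / 2 * d2 + (x1 + x2 - x3) / 2 * d3) -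
      (3.5 * d4 + 3.5 * d5 + 0.6 * d6) = n6 * d1 + n5 * d2 + n4 * d3 + n3 * d4 + n2 * d5 + n1 * d6 -
      (q * ((x2 + x3 - x1) / 2) * d1 + q * ((x1 + x3 - x2) / 2) * d2 + q * ((x1 + x2 - x3) / 2) * d3) -
      (3.5 * d4 + 3.5 * d5 + 0.6 * d6) := by ring
  rw [e]
  generalize q * ((x2 + x3 - x1) / 2) = y1 at *
  generalize q * ((x1 + x3 - x2) / 2) = y2 at *
  generalize q * ((x1 + x2 - x3) / 2) = y3 at *
  clear e b1 b1' b2 b2' b3 b3' q0 q1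
  have a1 := mul_pos (sub_pos.2 hc) (by linarith [h6.2] : 0 < -(n6 - y1))
  have a2 := mul_nonneg k2 (by linarith [h6.1, h5.2] : 0 ≤ -((n5 - y2) - 0.1 * (n6 - y1)))
  have a3 := mul_nonneg k3 (by linarith [h6.1, h4.2] : 0 ≤ -((n4 - y3) - 0.1 * (n6 - y1)))
  have a4 := mul_nonneg k4 (by linarith [h6.2, h3.2] : 0 ≤ -((n3 - 3.5) + 2 * (n6 - y1)))
  have a5 := mul_nonneg k5 (by linarith [h6.2, h2.2] : 0 ≤ -((n2 - 3.5) + 2 * (n6 - y1)))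
  have a6 := mul_nonneg k6 (by linarith [h6.2, h1.2] : 0 ≤ -((n1 - 0.6) + (n6 - y1)))
  linarith

lemma constr {ab ac bc ad bd cd ab0 ac0 bc0 ad0 bd0 cd0 q : ℝ} (h : Box ab ac bc ad bd cd)
    (h0 : Box ab0 ac0 bc0 ad0 bd0 cd0) (q0 : 0.17 ≤ q) (q1 : q ≤ 0.173)
    (hdAC : ac0 ≤ ac) (hdBC : bc0 ≤ bc) (hdAD : ad0 ≤ ad) (hdBD : bd0 ≤ bd) (hdCD : cd0 ≤ cd)
    (g0 : Gd ab0 ac0 bc0 ad0 bd0 cd0 = q * PP ab0 ac0 bc0)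
    (g1 : q * PP ab ac bc + 3.5 * (ad - ad0) + 3.5 * (bd - bd0) + 0.6 * (cd - cd0) ≤
      Gd ab ac bc ad bd cd) :
    ab - ab0 ≤ -0.1 * ((ac - ac0) + (bc - bc0)) + 2 * ((ad - ad0) + (bd - bd0)) + (cd - cd0) := by
  by_contra hc
  push Not at hc
  have key : ∀ t : ℝ, HasDerivAt (fun s =>
      Gd (ab0 + s * (ab - ab0)) (ac0 + s * (ac - ac0)) (bc0 + s * (bc - bc0))
      (ad0 + s * (ad - ad0)) (bd0 + s * (bd - bd0)) (cd0 + s * (cd - cd0)) -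
      q * PP (ab0 + s * (ab - ab0)) (ac0 + s * (ac - ac0)) (bc0 + s * (bc - bc0)) -
      (0 + s * (3.5 * (ad - ad0) + 3.5 * (bd - bd0) + 0.6 * (cd - cd0)))) _ t := fun t =>
    ((Gd_deriv (lind _ _ t) (lind _ _ t) (lind _ _ t) (lind _ _ t) (lind _ _ t) (lind _ _ t)).sub
    ((PP_deriv (lind _ _ t) (lind _ _ t) (lind _ _ t)).const_mul q)).sub (lind _ _ t)
  obtain ⟨t, ht, e⟩ := exists_hasDerivAt_eq_slope _ _ (zero_lt_one (α := ℝ))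
    (fun t _ => (key t).continuousAt.continuousWithinAt) (fun t _ => key t)
  have hB := h.seg h0 ht.1.le ht.2.le
  have a := constr_alg q0 q1 hB.ab hB.ac hB.bc (bN_AB hB) (bN_AC hB) (bN_AC hB.swap) (bN_AD hB)
    (bN_AD hB.swap) (bN_CD hB) (sub_nonneg.2 hdAC) (sub_nonneg.2 hdBC) (sub_nonneg.2 hdAD)
    (sub_nonneg.2 hdBD) (sub_nonneg.2 hdCD) hc
  rw [e] at a
  simp only [zero_mul, add_zero, one_mul, add_sub_cancel, zero_add, sub_zero, div_one] at a
  linarith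

-- Part Supp

lemma gram_id (a b c ab ac bc x y z : ℝ) : 
    gdet a b c ab ac bc * (x * (x * a + y * ab + z * ac) + y * (x * ab + y * b + z * bc) +
      z * (x * ac + y * bc + z * c)) =
    (b * c - bc ^ 2) * (x * a + y * ab + z * ac) ^ 2 + (a * c - ac ^ 2) * (x * ab + y * b + z * bc) ^ 2
    + (a * b - ab ^ 2) * (x * ac + y * bc + z * c) ^ 2
    - 2 * (ab * c - ac * bc) * (x * a + y * ab + z * ac) * (x * ab + y * b + z * bc)
    - 2 * (ac * b - ab * bc) * (x * a + y * ab + z * ac) * (x * ac + y * bc + z * c)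
    - 2 * (bc * a - ab * ac) * (x * ab + y * b + z * bc) * (x * ac + y * bc + z * c) := by
  unfold gdet; ring

lemma quad_alg {pa pb pc nab nac nbc ha hb hc : ℝ} (h1 : 0 ≤ ha) (h2 : 0 ≤ hb) (h3 : 0 ≤ hc)
    (hpa : 1 ≤ pa) (hpb : 1 ≤ pb) (hpc : 1 ≤ pc) (hab : nab ≤ 0) (hac : nac ≤ 0.03) (hbc : nbc ≤ 0.03) :
    0 ≤ pa * ha ^ 2 + pb * hb ^ 2 + pc * hc ^ 2 - 2 * nab * (ha * hb) - 2 * nac * (ha * hc)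
      - 2 * nbc * (hb * hc) := by
  have a1 := mul_nonneg (neg_nonneg.2 hab) (mul_nonneg h1 h2)
  have a2 := mul_nonneg (sub_nonneg.2 hac) (mul_nonneg h1 h3)
  have a3 := mul_nonneg (sub_nonneg.2 hbc) (mul_nonneg h2 h3)
  have a4 := mul_nonneg (sub_nonneg.2 hpa) (sq_nonneg ha)
  have a5 := mul_nonneg (sub_nonneg.2 hpb) (sq_nonneg hb)
  have a6 := mul_nonneg (sub_nonneg.2 hpc) (sq_nonneg hc)
  linarith [sq_nonneg (ha - hc), sq_nonneg (hb - hc), sq_nonneg ha, sq_nonneg hb, sq_nonneg hc]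

lemma supp_alg {pa pb pc nab nac nbc P G r τ ha hb hc : ℝ} (hr : r ^ 2 = 1 - 2 * r) (r0 : 0 < r)
    (t0 : 0 ≤ τ) (t1 : τ < r) (r1 : r < 1)
    (h1 : 0 ≤ ha) (h2 : 0 ≤ hb) (h3 : 0 ≤ hc)
    (hpa : |pa - 4.0128| ≤ 0.013) (hpb : |pb - 4.0128| ≤ 0.013) (hpc : |pc - 1.3826| ≤ 0.0445)
    (hab : |nab - (-3.2488)| ≤ 0.0248) (hac : |nac - 0.0034| ≤ 0.02) (hbc : |nbc - 0.0034| ≤ 0.02)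
    (hP : pa + pb + pc - 2 * nab - 2 * nac - 2 * nbc = P) (P0 : 0 ≤ P) 
    (h : G * (2 * r - τ) ^ 2 = pa * (2 * r ^ 2 + (1 - r) * τ + ha / 2) ^ 2
      + pb * (2 * r ^ 2 + (1 - r) * τ + hb / 2) ^ 2 + pc * (2 * r ^ 2 + (1 - r) * τ + hc / 2) ^ 2
      - 2 * nab * (2 * r ^ 2 + (1 - r) * τ + ha / 2) * (2 * r ^ 2 + (1 - r) * τ + hb / 2)
      - 2 * nac * (2 * r ^ 2 + (1 - r) * τ + ha / 2) * (2 * r ^ 2 + (1 - r) * τ + hc / 2)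
      - 2 * nbc * (2 * r ^ 2 + (1 - r) * τ + hb / 2) * (2 * r ^ 2 + (1 - r) * τ + hc / 2)) :
    r ^ 2 * P + 3.5 * ha + 3.5 * hb + 0.6 * hc ≤ G := by
  have hq : 0 ≤ pa * ha ^ 2 + pb * hb ^ 2 + pc * hc ^ 2 - 2 * nab * (ha * hb) - 2 * nac * (ha * hc)
      - 2 * nbc * (hb * hc) := by
    rw [abs_le] at *
    exact quad_alg h1 h2 h3 (by linarith [hpa.1]) (by linarith [hpb.1]) (by linarith [hpc.1])
      (by linarith [hab.2]) (by linarith [hac.2]) (by linarith [hbc.2])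
  set π0 := 2 * r ^ 2 + (1 - r) * τ with hπ
  set s := 2 * r - τ with hs
  have s0 : 0 < s := by linarith
  have p1 : r * s ≤ π0 := by
    have : π0 = r * s + τ := by rw [hπ, hs]; ring
    linarith
  have p0 : 0 < π0 := lt_of_lt_of_le (mul_pos r0 s0) p1
  have p2 : s ^ 2 ≤ 2 * π0 := by
    have e1 : s ^ 2 = 2 * (r * s) - τ * s := by rw [hs]; ring
    have e2 := mul_nonneg t0 s0.le
    linarith
  have p3 : r ^ 2 * s ^ 2 ≤ π0 ^ 2 := by
    rw [← mul_pow]; exact pow_le_pow_left₀ (mul_pos r0 s0).le p1 2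
  have w : 3.5 * ha + 3.5 * hb + 0.6 * hc ≤ ((pa - nab - nac) * ha + (pb - nab - nbc) * hb + (pc - nac - nbc) * hc) / 2 := by
    rw [abs_le] at *
    have a1 := mul_nonneg (by linarith [hab.2, hac.2, hpa.1] : 0 ≤ (pa - nab - nac) - 7) h1
    have a2 := mul_nonneg (by linarith [hab.2, hbc.2, hpb.1] : 0 ≤ (pb - nab - nbc) - 7) h2
    have a3 := mul_nonneg (by linarith [hac.2, hbc.2, hpc.1] : 0 ≤ (pc - nac - nbc) - 1.2) h3
    linarith
  have w0 : 0 ≤ 3.5 * ha + 3.5 * hb + 0.6 * hc := by positivity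
  have e : G * s ^ 2 = π0 ^ 2 * P + (2 * π0) * (((pa - nab - nac) * ha + (pb - nab - nbc) * hb + (pc - nac - nbc) * hc) / 2) + (pa * ha ^ 2 + pb * hb ^ 2 + pc * hc ^ 2 - 2 * nab * (ha * hb) - 2 * nac * (ha * hc)
      - 2 * nbc * (hb * hc)) / 4 := by
    rw [h, ← hP]; ring
  have k1 := mul_le_mul_of_nonneg_right p3 P0
  have k2 := mul_le_mul p2 w w0 (by linarith)
  have : (r ^ 2 * P + 3.5 * ha + 3.5 * hb + 0.6 * hc) * s ^ 2 ≤ G * s ^ 2 := by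
    rw [e]; linarith
  exact le_of_mul_le_mul_right this (by positivity)

lemma supp {A B C D O : EuclideanSpace ℝ (Fin 3)} (h : AffineIndependent ℝ ![A, B, C, D]) {r R : ℝ}
    (hr : r ^ 2 = 1 - 2 * r) (r0 : 0 < r) (R0 : 0 < R) (R1 : R ≤ r) (r1 : r < 1)
    (hOA : dist O A = 1 + R) (hOB : dist O B = 1 + R) (hOC : dist O C = 1 + R)
    (hOD : dist O D = r + R)
    (hB : Box (dist A B ^ 2) (dist A C ^ 2) (dist B C ^ 2)
        (dist A D ^ 2) (dist B D ^ 2) (dist C D ^ 2))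
    (h1 : 2 ≤ dist A D ^ 2) (h2 : 2 ≤ dist B D ^ 2) (h3 : 2 ≤ dist C D ^ 2) :
    r ^ 2 * PP (dist A B ^ 2) (dist A C ^ 2) (dist B C ^ 2) + 3.5 * (dist A D ^ 2 - 2) +
      3.5 * (dist B D ^ 2 - 2) + 0.6 * (dist C D ^ 2 - 2) ≤
    Gd (dist A B ^ 2) (dist A C ^ 2) (dist B C ^ 2)
        (dist A D ^ 2) (dist B D ^ 2) (dist C D ^ 2) := by
  obtain ⟨x, y, z, hp⟩ := (Ind_of h).span (O - D)
  have iA := inner_dist D O A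
  have iB := inner_dist D O B
  have iC := inner_dist D O C
  have iO := inner_dist' D O
  have aa := inner_dist' D A
  have bb := inner_dist' D B
  have cc := inner_dist' D C
  have ab := inner_dist D A B
  have ac := inner_dist D A C
  have bc := inner_dist D B C
  have g := gram_id (inner ℝ (A - D) (A - D)) (inner ℝ (B - D) (B - D)) (inner ℝ (C - D) (C - D))
    (inner ℝ (A - D) (B - D)) (inner ℝ (A - D) (C - D)) (inner ℝ (B - D) (C - D)) x y z
  have fA : inner ℝ (O - D) (A - D) = x * inner ℝ (A - D) (A - D) + y * inner ℝ (A - D) (B - D) +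
      z * inner ℝ (A - D) (C - D) := by
    rw [hp]; simp only [inner_add_left, real_inner_smul_left]
    rw [real_inner_comm (A - D) (B - D), real_inner_comm (A - D) (C - D)]
  have fB : inner ℝ (O - D) (B - D) = x * inner ℝ (A - D) (B - D) + y * inner ℝ (B - D) (B - D) +
      z * inner ℝ (B - D) (C - D) := by
    rw [hp]; simp only [inner_add_left, real_inner_smul_left]; rw [real_inner_comm (B - D) (C - D)]
  have fC : inner ℝ (O - D) (C - D) = x * inner ℝ (A - D) (C - D) + y * inner ℝ (B - D) (C - D) +
      z * inner ℝ (C - D) (C - D) := by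
    rw [hp]; simp only [inner_add_left, real_inner_smul_left]
  have fO : inner ℝ (O - D) (O - D) = x * inner ℝ (O - D) (A - D) + y * inner ℝ (O - D) (B - D) +
      z * inner ℝ (O - D) (C - D) := by
    have e : inner ℝ (O - D) (O - D) = inner ℝ (O - D) (x • (A - D) + y • (B - D) + z • (C - D)) := by
      rw [← hp]
    rw [e, inner_add_right, inner_add_right, real_inner_smul_right, real_inner_smul_right,
      real_inner_smul_right]
  rw [← fA, ← fB, ← fC, ← fO, iA, iB, iC, iO, aa, bb, cc, ab, ac, bc, dist_comm D O, dist_comm D A,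
    dist_comm D B, dist_comm D C, hOA, hOB, hOC, hOD] at g
  refine supp_alg (τ := r - R) hr r0 (by linarith) (by linarith) r1 (by linarith) (by linarith)
    (by linarith) (bP_ACD hB.swap) (bP_ACD hB) (bP_ABD hB) (bN_CD hB) (bN_AD hB.swap) (bN_AD hB)
    ?_ ?_ ?_
  · unfold PP NN; ring
  · have := abs_le.1 (bP_ABC hB)
    linarith [this.1]
  · have q : ∀ X : ℝ, (((r + R) ^ 2 + X - (1 + R) ^ 2) / 2) = 
        2 * r ^ 2 + (1 - r) * (r - R) + (X - 2) / 2 := by intro X; linear_combination (-1 / 2) * hr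
    rw [q, q, q] at g
    have e1 : 2 * r - (r - R) = r + R := by ring
    rw [e1]
    unfold Gd
    rw [g]
    unfold PP NN
    ring

-- Part Tz

lemma acos_le {x u : ℝ} (u0 : 0 ≤ u) (u1 : u ≤ Real.pi) (h : Real.cos u ≤ x) : Real.arccos x ≤ u := by
  have := Real.antitone_arccos h
  rwa [Real.arccos_cos u0 u1] at this

lemma le_acos {x u : ℝ} (u0 : 0 ≤ u) (u1 : u ≤ Real.pi) (h : x ≤ Real.cos u) : u ≤ Real.arccos x := by
  have := Real.antitone_arccos h
  rwa [Real.arccos_cos u0 u1] at this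

lemma sin_bd (x : ℝ) (h : |x| ≤ 1) : x - x ^ 3 / 6 - x ^ 4 * (5 / 96) ≤ Real.sin x ∧
    Real.sin x ≤ x - x ^ 3 / 6 + x ^ 4 * (5 / 96) := by
  have := abs_le.1 (Real.sin_bound h)
  have e : |x| ^ 4 = x ^ 4 := by rw [← abs_pow, abs_of_nonneg (by positivity)]
  have e5 : |x| ^ 5 ≤ x ^ 4 := by
    rw [← e]; exact pow_le_pow_of_le_one (abs_nonneg x) h (by norm_num)
  have e6 : 0 ≤ x ^ 4 := by positivity
  constructor <;> linarith [this.1, this.2]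

lemma cos_half (x : ℝ) : Real.cos x = 1 - 2 * Real.sin (x / 2) ^ 2 := by
  have := Real.cos_sq' (x / 2)
  have h2 := Real.cos_two_mul (x / 2)
  rw [mul_div_cancel₀ x two_ne_zero] at h2
  linarith

lemma L_bd : 7.2493 ≤ 32 * (3 - Real.sqrt 2) / 7 ∧ 32 * (3 - Real.sqrt 2) / 7 ≤ 7.2494 ∧
    0.41421 ≤ Real.sqrt 2 - 1 ∧ Real.sqrt 2 - 1 ≤ 0.41422 := by
  have a : 1.414213 ≤ Real.sqrt 2 := Real.le_sqrt_of_sq_le (by norm_num)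
  have b : Real.sqrt 2 ≤ 1.414214 := Real.sqrt_le_iff.2 ⟨by norm_num, by norm_num⟩
  refine ⟨?_, ?_, ?_, ?_⟩ <;> linarith

lemma Gd0 : Gd (32 * (3 - Real.sqrt 2) / 7) 4 4 2 2 2 =
    (Real.sqrt 2 - 1) ^ 2 * PP (32 * (3 - Real.sqrt 2) / 7) 4 4 := by
  have h : Real.sqrt 2 ^ 2 = 2 := Real.sq_sqrt (by norm_num)
  generalize Real.sqrt 2 = s at *
  unfold Gd gdet PP
  have h3 : s ^ 3 = 2 * s := by rw [pow_succ, h]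
  have h4 : s ^ 4 = 4 := by rw [show s ^ 4 = (s ^ 2) ^ 2 by ring, h]; norm_num
  ring_nf
  rw [h4, h3, h]
  ring

lemma thAB {L : ℝ} (h1 : 7.2493 ≤ L) (h2 : L ≤ 7.2494) :
    1.272 ≤ dE L 4 2 4 2 2 ∧ dE L 4 2 4 2 2 ≤ 1.275 := by
  have hpi := Real.pi_gt_d4
  have hpi' := Real.pi_lt_d4
  have p1 : 3.9822 ≤ Real.sqrt (PP L 4 4) := Real.le_sqrt_of_sq_le (by unfold PP; nlinarith)
  have p2 : Real.sqrt (PP L 4 4) ≤ 3.9825 := Real.sqrt_le_iff.2 ⟨by norm_num, by unfold PP; nlinarith⟩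
  have q1 : 1.1662 ≤ Real.sqrt (PP L 2 2) := Real.le_sqrt_of_sq_le (by unfold PP; nlinarith)
  have q2 : Real.sqrt (PP L 2 2) ≤ 1.1665 := Real.sqrt_le_iff.2 ⟨by norm_num, by unfold PP; nlinarith⟩
  have n1 : 1.3601 ≤ NN L 4 2 4 2 2 := by unfold NN; nlinarith
  have n2 : NN L 4 2 4 2 2 ≤ 1.3606 := by unfold NN; nlinarith
  have a1 : 3.9822 * 1.1662 ≤ Real.sqrt (PP L 4 4) * Real.sqrt (PP L 2 2) := by gcongr
  have a2 : Real.sqrt (PP L 4 4) * Real.sqrt (PP L 2 2) ≤ 3.9825 * 1.1665 := by gcongr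
  rw [dE_eq]
  constructor
  · refine le_acos (by norm_num) (by linarith) ?_
    rw [← Real.sin_pi_div_two_sub]
    have s := (sin_bd 0.2987 (by norm_num)).1
    have m : Real.sin 0.2987 ≤ Real.sin (Real.pi / 2 - 1.272) :=
      Real.sin_le_sin_of_le_of_le_pi_div_two (by linarith) (by linarith) (by linarith)
    refine le_trans ?_ (s.trans m)
    rw [div_le_iff₀ (by linarith)]
    nlinarith
  · refine acos_le (by norm_num) (by linarith) ?_
    rw [← Real.sin_pi_div_two_sub]
    have s := (sin_bd 0.2959 (by norm_num)).2
    have m : Real.sin (Real.pi / 2 - 1.275) ≤ Real.sin 0.2959 :=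
      Real.sin_le_sin_of_le_of_le_pi_div_two (by linarith) (by linarith) (by linarith)
    refine le_trans (m.trans s) ?_
    rw [le_div_iff₀ (by linarith)]
    nlinarith

lemma thAC {L : ℝ} (h1 : 7.2493 ≤ L) (h2 : L ≤ 7.2494) :
    0.4255 ≤ dE 4 L 2 4 2 2 ∧ dE 4 L 2 4 2 2 ≤ 0.4285 := by
  have hpi := Real.pi_gt_d4
  have p1 : 3.9822 ≤ Real.sqrt (PP 4 L 4) := Real.le_sqrt_of_sq_le (by unfold PP; nlinarith)
  have p2 : Real.sqrt (PP 4 L 4) ≤ 3.9825 := Real.sqrt_le_iff.2 ⟨by norm_num, by unfold PP; nlinarith⟩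
  have q : Real.sqrt (PP 4 2 2) = 2 := by
    rw [show PP 4 2 2 = 2 ^ 2 by unfold PP; norm_num, Real.sqrt_sq (by norm_num)]
  have n : NN 4 L 2 4 2 2 = L := by unfold NN; ring
  rw [dE_eq, q, n]
  constructor
  · refine le_acos (by norm_num) (by linarith) ?_
    rw [cos_half]
    have s := (sin_bd (0.4255 / 2) (by norm_num [abs_le])).2
    have s' := Real.sin_nonneg_of_nonneg_of_le_pi (x := 0.4255 / 2) (by norm_num) (by linarith)
    have m := pow_le_pow_left₀ s' s 2
    rw [div_le_iff₀ (by linarith)]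
    have : (0.9103:ℝ) ≤ 1 - 2 * Real.sin (0.4255 / 2) ^ 2 := by
      refine le_trans ?_ (sub_le_sub_left (mul_le_mul_of_nonneg_left m zero_le_two) 1)
      norm_num
    nlinarith
  · refine acos_le (by norm_num) (by linarith) ?_
    rw [cos_half]
    have s := (sin_bd (0.4285 / 2) (by norm_num [abs_le])).1
    have m := pow_le_pow_left₀ (by norm_num) s 2
    rw [le_div_iff₀ (by linarith)]
    have : 1 - 2 * Real.sin (0.4285 / 2) ^ 2 ≤ (0.9101:ℝ) := by
      refine le_trans (sub_le_sub_left (mul_le_mul_of_nonneg_left m zero_le_two) 1) ?_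
      norm_num
    nlinarith

lemma thCD {L : ℝ} (h1 : 7.2493 ≤ L) (h2 : L ≤ 7.2494) :
    2.516 ≤ dE 2 4 4 2 2 L ∧ dE 2 4 4 2 2 L ≤ 2.522 := by
  have hpi := Real.pi_gt_d4
  have hpi' := Real.pi_lt_d4
  have q : Real.sqrt (PP 2 4 2) = 2 := by
    rw [show PP 2 4 2 = 2 ^ 2 by unfold PP; norm_num, Real.sqrt_sq (by norm_num)]
  have n : NN 2 4 4 2 2 L = 4 - L := by unfold NN; ring
  rw [dE_eq, q, n]
  constructor
  · refine le_acos (by norm_num) (by linarith) ?_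
    rw [← neg_neg (Real.cos 2.516), ← Real.cos_pi_sub]
    have m : Real.cos (Real.pi - 2.516) ≤ Real.cos 0.6255 :=
      Real.cos_le_cos_of_nonneg_of_le_pi (by norm_num) (by linarith) (by linarith)
    rw [cos_half 0.6255] at m
    have s := (sin_bd (0.6255 / 2) (by norm_num [abs_le])).1
    have m' := pow_le_pow_left₀ (by norm_num) s 2
    have : 1 - 2 * Real.sin (0.6255 / 2) ^ 2 ≤ (0.8122:ℝ) := by
      refine le_trans (sub_le_sub_left (mul_le_mul_of_nonneg_left m' zero_le_two) 1) ?_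
      norm_num
    linarith
  · refine acos_le (by norm_num) (by linarith) ?_
    rw [← neg_neg (Real.cos 2.522), ← Real.cos_pi_sub]
    have m : Real.cos 0.6197 ≤ Real.cos (Real.pi - 2.522) :=
      Real.cos_le_cos_of_nonneg_of_le_pi (by linarith) (by linarith) (by linarith)
    rw [cos_half 0.6197] at m
    have s := (sin_bd (0.6197 / 2) (by norm_num [abs_le])).2
    have s' := Real.sin_nonneg_of_nonneg_of_le_pi (x := 0.6197 / 2) (by norm_num) (by linarith)
    have m' := pow_le_pow_left₀ s' s 2
    have : (0.8125:ℝ) ≤ 1 - 2 * Real.sin (0.6197 / 2) ^ 2 := by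
      refine le_trans ?_ (sub_le_sub_left (mul_le_mul_of_nonneg_left m' zero_le_two) 1)
      norm_num
    linarith

lemma k_bd : |SS (Real.sqrt 2 - 1) (32 * (3 - Real.sqrt 2) / 7) 4 4 2 2 2 /
    Real.sqrt (Gd (32 * (3 - Real.sqrt 2) / 7) 4 4 2 2 2) - 0.1354| ≤ 0.0036 := by
  obtain ⟨h1, h2, r1, r2⟩ := L_bd
  rw [Gd0]
  generalize 32 * (3 - Real.sqrt 2) / 7 = L at *
  generalize Real.sqrt 2 - 1 = r at *
  have hpi := Real.pi_gt_d4
  have hpi' := Real.pi_lt_d4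
  have p1 : 3.9822 ≤ Real.sqrt (PP L 4 4) := Real.le_sqrt_of_sq_le (by unfold PP; nlinarith)
  have p2 : Real.sqrt (PP L 4 4) ≤ 3.9825 := Real.sqrt_le_iff.2 ⟨by norm_num, by unfold PP; nlinarith⟩
  have a1 : 0.41421 * 3.9822 ≤ r * Real.sqrt (PP L 4 4) := by gcongr
  have a2 : r * Real.sqrt (PP L 4 4) ≤ 0.41422 * 3.9825 := by gcongr
  rw [Real.sqrt_mul (by positivity), Real.sqrt_sq (by linarith)]
  have d1 : dE 2 L 4 2 2 4 = Real.pi / 2 := by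
    rw [dE_eq, show NN 2 L 4 2 2 4 = 0 by unfold NN; ring, zero_div, Real.arccos_zero]
  have t1 := thAB h1 h2
  have t2 := thAC h1 h2
  have t3 := thCD h1 h2
  have c1 : (0.07106:ℝ) ≤ r ^ 3 := le_trans (by norm_num) (pow_le_pow_left₀ (by norm_num) r1 3)
  have c2 : r ^ 3 ≤ 0.07108 := le_trans (pow_le_pow_left₀ (by linarith) r2 3) (by norm_num)
  unfold SS
  rw [d1]
  have hS : 1 / 3 * (2 * (dE L 4 2 4 2 2 + dE 4 L 2 4 2 2 + dE 4 L 2 4 2 2) +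
      (1 + r ^ 3) * (Real.pi / 2 + Real.pi / 2 + dE 2 4 4 2 2 L) - (3 + r ^ 3) * Real.pi) =
      1 / 3 * (2 * dE L 4 2 4 2 2 + 4 * dE 4 L 2 4 2 2 + (1 + r ^ 3) * dE 2 4 4 2 2 L - 2 * Real.pi) := by
    ring
  rw [hS]
  generalize dE L 4 2 4 2 2 = x at *
  generalize dE 4 L 2 4 2 2 = y at *
  generalize dE 2 4 4 2 2 L = z at *
  have z1 : 1.07106 * 2.516 ≤ (1 + r ^ 3) * z := mul_le_mul (by linarith) t3.1 (by norm_num) (by linarith)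
  have z2 : (1 + r ^ 3) * z ≤ 1.07108 * 2.522 := mul_le_mul (by linarith) t3.2 (by linarith) (by norm_num)
  have pos : 0 < r * Real.sqrt (PP L 4 4) := by linarith
  rw [abs_le]
  constructor
  · rw [neg_le_sub_iff_le_add, ← sub_le_iff_le_add, le_div_iff₀ pos]
    nlinarith
  · rw [sub_le_iff_le_add, div_le_iff₀ pos]
    nlinarith

-- Part Fin

lemma norm_comb (P Q R S : EuclideanSpace ℝ (Fin 3)) (x y z : ℝ) :
    ‖x • (Q - P) + y • (R - P) + z • (S - P)‖ ^ 2 = x ^ 2 * dist P Q ^ 2 + y ^ 2 * dist P R ^ 2 +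
      z ^ 2 * dist P S ^ 2 + x * y * (dist P Q ^ 2 + dist P R ^ 2 - dist Q R ^ 2) +
      x * z * (dist P Q ^ 2 + dist P S ^ 2 - dist Q S ^ 2) +
      y * z * (dist P R ^ 2 + dist P S ^ 2 - dist R S ^ 2) := by
  have a := inner_dist P Q R
  have b := inner_dist P Q S
  have c := inner_dist P R S
  have d := inner_dist' P Q
  have e := inner_dist' P R
  have f := inner_dist' P S
  rw [← real_inner_self_eq_norm_sq]
  simp only [inner_add_left, inner_add_right, real_inner_smul_left, real_inner_smul_right]
  rw [real_inner_comm (Q - P) (R - P), real_inner_comm (Q - P) (S - P),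
    real_inner_comm (R - P) (S - P), a, b, c, d, e, f]
  ring

lemma inclD {s x y z : ℝ} (h : s ^ 2 = 2) (s1 : 1 ≤ s) (s2 : s ≤ 2) :
    (s - 1) ^ 2 * (x + y + z) ^ 2 ≤ x ^ 2 * 2 + y ^ 2 * 2 + z ^ 2 * 2 +
      x * y * (2 + 2 - 32 * (3 - s) / 7) + x * z * (2 + 2 - 4) + y * z * (2 + 2 - 4) := by
  have e : (2 * s - 1) * (x ^ 2 * 2 + y ^ 2 * 2 + z ^ 2 * 2 +
      x * y * (2 + 2 - 32 * (3 - s) / 7) + x * z * (2 + 2 - 4) + y * z * (2 + 2 - 4) -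
      (3 - 2 * s) * (x + y + z) ^ 2) = ((2 * s - 1) * z - (3 - 2 * s) * (x + y)) ^ 2 +
      (2 * s - 1) * (8 * (3 - s) / 7) * (x - y) ^ 2 := by
    linear_combination (16 / 7) * (x + y) ^ 2 * h
  have e2 : (s - 1) ^ 2 = 3 - 2 * s := by linear_combination h
  rw [e2]
  have p : 0 < 2 * s - 1 := by linarith
  have p2 : 0 ≤ 8 * (3 - s) / 7 := by linarith
  have : 0 ≤ (2 * s - 1) * (x ^ 2 * 2 + y ^ 2 * 2 + z ^ 2 * 2 +
      x * y * (2 + 2 - 32 * (3 - s) / 7) + x * z * (2 + 2 - 4) + y * z * (2 + 2 - 4) -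
      (3 - 2 * s) * (x + y + z) ^ 2) := by
    rw [e]; positivity
  have := nonneg_of_mul_nonneg_right this p
  linarith

lemma Lsq : (4 * Real.sqrt (2 * (Real.sqrt 2 - 1) / (1 + 2 * (Real.sqrt 2 - 1)))) ^ 2 =
    32 * (3 - Real.sqrt 2) / 7 := by
  have h : Real.sqrt 2 ^ 2 = 2 := Real.sq_sqrt (by norm_num)
  obtain ⟨-, -, r1, -⟩ := L_bd
  rw [mul_pow, Real.sq_sqrt (div_nonneg (by linarith) (by linarith)), mul_div_assoc', div_eq_div_iff
    (by linarith) (by norm_num)]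
  linear_combination 64 * h

lemma box_mem {x c r l u : ℝ} (h : x ∈ Set.Icc l u) (l0 : 0 ≤ l) (h1 : c - r ≤ l ^ 2)
    (h2 : u ^ 2 ≤ c + r) : |x ^ 2 - c| ≤ r := by
  have a := pow_le_pow_left₀ l0 h.1 2
  have b := pow_le_pow_left₀ (l0.trans h.1) h.2 2
  rw [abs_le]; constructor <;> linarith

lemma low0 {A B C D : EuclideanSpace ℝ (Fin 3)}
    (haff : AffineIndependent ℝ ![A, B, C, D])
    (hAB : dist A B ^ 2 = 32 * (3 - Real.sqrt 2) / 7)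
    (hAC : dist A C = 2) (hBC : dist B C = 2)
    (hAD : dist A D = Real.sqrt 2) (hBD : dist B D = Real.sqrt 2)
    (hCD : dist C D = Real.sqrt 2) :
    SS (Real.sqrt 2 - 1) (dist A B ^ 2) (dist A C ^ 2) (dist B C ^ 2)
        (dist A D ^ 2) (dist B D ^ 2) (dist C D ^ 2) ≤
    volume.real (tetra A B C D ∩
    (closedBall A 1 ∪ closedBall B 1 ∪ closedBall C 1 ∪ closedBall D (Real.sqrt 2 - 1))) := by
  have h : Real.sqrt 2 ^ 2 = 2 := Real.sq_sqrt (by norm_num)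
  obtain ⟨l1, l2, r1, r2⟩ := L_bd
  have e : 1 + (Real.sqrt 2 - 1) = Real.sqrt 2 := by ring
  have four : (2:ℝ) ^ 2 = 4 := by norm_num
  refine lower_T haff _ (by linarith) ?_ hAC.ge hBC.ge (by rw [e, hAD]) (by rw [e, hBD])
    (by rw [e, hCD]) ?_ ?_ ?_ ?_
  · refine (pow_le_pow_iff_left₀ (by norm_num) dist_nonneg two_ne_zero).1 ?_
    rw [hAB]; linarith
  · refine sec_lower B C D A 1 zero_lt_one fun x y z hx hy hz => ?_
    rw [norm_comb, hAB, hAC, hAD, hBC, hBD, hCD, h, four]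
    have xy := mul_nonneg hx hy
    have xz := mul_nonneg hx hz
    have yz := mul_nonneg hy hz
    nlinarith [sq_nonneg x, sq_nonneg y, sq_nonneg z, mul_nonneg (sub_nonneg.2 l1) (sq_nonneg x), mul_nonneg (sub_nonneg.2 l1) xy, mul_nonneg (sub_nonneg.2 l1) xz]
  · refine sec_lower C D A B 1 zero_lt_one fun x y z hx hy hz => ?_
    rw [norm_comb, dist_comm B A, dist_comm C A, dist_comm D A, hAB, hAC, hAD, hBC, hBD, hCD, h, four]
    have xy := mul_nonneg hx hy
    have xz := mul_nonneg hx hz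
    have yz := mul_nonneg hy hz
    nlinarith [sq_nonneg x, sq_nonneg y, sq_nonneg z, mul_nonneg (sub_nonneg.2 l1) (sq_nonneg z), mul_nonneg (sub_nonneg.2 l1) yz, mul_nonneg (sub_nonneg.2 l1) xz]
  · refine sec_lower D A B C 1 zero_lt_one fun x y z hx hy hz => ?_
    rw [norm_comb, dist_comm C A, dist_comm C B, dist_comm D A, dist_comm D B, hAB, hAC, hAD, hBC, hBD, hCD, h, four]
    have xy := mul_nonneg hx hy
    have xz := mul_nonneg hx hz
    have yz := mul_nonneg hy hz
    nlinarith [sq_nonneg x, sq_nonneg (y - z), sq_nonneg z, mul_nonneg (sub_nonneg.2 l2) yz]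
  · refine sec_lower A B C D _ (by linarith) fun x y z hx hy hz => ?_
    rw [norm_comb, dist_comm D A, dist_comm D B, dist_comm D C, hAB, hAC, hAD, hBC, hBD, hCD, h, four]
    exact inclD h (by linarith) (by linarith)

theorem local_111r
    (A B C D A₀ B₀ C₀ D₀ : EuclideanSpace ℝ (Fin 3))
    (haff : AffineIndependent ℝ ![A, B, C, D])
    (hAB : dist A B ∈ Set.Icc
      (4 * Real.sqrt (2 * (Real.sqrt 2 - 1) / (1 + 2 * (Real.sqrt 2 - 1))) - 1 / 445)
      (4 * Real.sqrt (2 * (Real.sqrt 2 - 1) / (1 + 2 * (Real.sqrt 2 - 1))) + 1 / 445))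
    (hAC : dist A C ∈ Set.Icc (2 : ℝ) (2 + 1 / 445))
    (hBC : dist B C ∈ Set.Icc (2 : ℝ) (2 + 1 / 445))
    (hAD : dist A D ∈ Set.Icc (1 + (Real.sqrt 2 - 1)) (1 + (Real.sqrt 2 - 1) + 1 / 445))
    (hBD : dist B D ∈ Set.Icc (1 + (Real.sqrt 2 - 1)) (1 + (Real.sqrt 2 - 1) + 1 / 445))
    (hCD : dist C D ∈ Set.Icc (1 + (Real.sqrt 2 - 1)) (1 + (Real.sqrt 2 - 1) + 1 / 445))
    (hdisjAB : 2 ≤ dist A B)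
    (hsupp : ∃ O : EuclideanSpace ℝ (Fin 3), ∃ R : ℝ, 0 < R ∧ R ≤ Real.sqrt 2 - 1 ∧
      dist O A = 1 + R ∧ dist O B = 1 + R ∧ dist O C = 1 + R ∧
      dist O D = (Real.sqrt 2 - 1) + R)
    (haff₀ : AffineIndependent ℝ ![A₀, B₀, C₀, D₀])
    (hAB₀ : dist A₀ B₀ =
      4 * Real.sqrt (2 * (Real.sqrt 2 - 1) / (1 + 2 * (Real.sqrt 2 - 1))))
    (hAC₀ : dist A₀ C₀ = 2) (hBC₀ : dist B₀ C₀ = 2)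
    (hAD₀ : dist A₀ D₀ = 1 + (Real.sqrt 2 - 1)) (hBD₀ : dist B₀ D₀ = 1 + (Real.sqrt 2 - 1))
    (hCD₀ : dist C₀ D₀ = 1 + (Real.sqrt 2 - 1)) :
    density A B C D 1 1 1 (Real.sqrt 2 - 1) ≤
      density A₀ B₀ C₀ D₀ 1 1 1 (Real.sqrt 2 - 1) := by
  have h : Real.sqrt 2 ^ 2 = 2 := Real.sq_sqrt (by norm_num)
  obtain ⟨l1, l2, r1, r2⟩ := L_bd
  have e : 1 + (Real.sqrt 2 - 1) = Real.sqrt 2 := by ring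
  rw [e] at hAD hBD hCD hAD₀ hBD₀ hCD₀
  have hL := Lsq
  have hL0 : 0 ≤ 4 * Real.sqrt (2 * (Real.sqrt 2 - 1) / (1 + 2 * (Real.sqrt 2 - 1))) := by positivity
  generalize 4 * Real.sqrt (2 * (Real.sqrt 2 - 1) / (1 + 2 * (Real.sqrt 2 - 1))) = L at *
  have L1 : 2.69245 ≤ L := by nlinarith
  have L2 : L ≤ 2.6925 := by nlinarith
  have bx : Box (dist A B ^ 2) (dist A C ^ 2) (dist B C ^ 2)
      (dist A D ^ 2) (dist B D ^ 2) (dist C D ^ 2) := by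
    have k1 : ∀ x : ℝ, x ∈ Set.Icc (2 : ℝ) (2 + 1 / 445) → |x ^ 2 - 4.0045| ≤ 0.0045 :=
      fun x hx => box_mem hx (by norm_num) (by norm_num) (by norm_num)
    have k2 : ∀ x : ℝ, x ∈ Set.Icc (Real.sqrt 2) (Real.sqrt 2 + 1 / 445) → |x ^ 2 - 2.0032| ≤ 0.0032 :=
      fun x hx => box_mem hx (by positivity) (by rw [h]; norm_num) (by nlinarith)
    refine ⟨?_, k1 _ hAC, k1 _ hBC, k2 _ hAD, k2 _ hBD, k2 _ hCD⟩
    have : dist A B ∈ Set.Icc (2.6902 : ℝ) 2.6948 := ⟨by linarith [hAB.1], by linarith [hAB.2]⟩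
    exact box_mem this (by norm_num) (by norm_num) (by norm_num)
  have bx0 : Box (32 * (3 - Real.sqrt 2) / 7) 4 4 2 2 2 := by
    refine ⟨?_, ?_, ?_, ?_, ?_, ?_⟩
    · rw [abs_le]; constructor <;> linarith
    all_goals norm_num [abs_le]
  have mAC : 4 ≤ dist A C ^ 2 := by nlinarith [hAC.1]
  have mBC : 4 ≤ dist B C ^ 2 := by nlinarith [hBC.1]
  have mAD : 2 ≤ dist A D ^ 2 := by
    have := pow_le_pow_left₀ (Real.sqrt_nonneg 2) hAD.1 2
    rwa [h] at this
  have mBD : 2 ≤ dist B D ^ 2 := by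
    have := pow_le_pow_left₀ (Real.sqrt_nonneg 2) hBD.1 2
    rwa [h] at this
  have mCD : 2 ≤ dist C D ^ 2 := by
    have := pow_le_pow_left₀ (Real.sqrt_nonneg 2) hCD.1 2
    rwa [h] at this
  obtain ⟨O, R, R0, R1, hOA, hOB, hOC, hOD⟩ := hsupp
  have hr : (Real.sqrt 2 - 1) ^ 2 = 1 - 2 * (Real.sqrt 2 - 1) := by linear_combination h
  have g1 := supp haff hr (by linarith) R0 R1 (by linarith) hOA hOB hOC hOD bx mAD mBD mCD
  have cn := constr bx bx0 (by rw [hr]; linarith) (by rw [hr]; linarith) mAC mBC mAD mBD mCD Gd0 g1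
  have hAB2 : dist A₀ B₀ ^ 2 = 32 * (3 - Real.sqrt 2) / 7 := by rw [hAB₀, hL]
  refine dens_le haff haff₀ (upper_T haff _ (by linarith))
    (low0 haff₀ hAB2 hAC₀ hBC₀ hAD₀ hBD₀ hCD₀) ?_
  rw [hAB2, hAC₀, hBC₀, hAD₀, hBD₀, hCD₀, h, show (2:ℝ) ^ 2 = 4 by norm_num]
  have c1 : (0.07106:ℝ) ≤ (Real.sqrt 2 - 1) ^ 3 := le_trans (by norm_num) (pow_le_pow_left₀ (by norm_num) r1 3)
  have c2 : (Real.sqrt 2 - 1) ^ 3 ≤ 0.07108 := le_trans (pow_le_pow_left₀ (by linarith) r2 3) (by norm_num)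
  have m := Phi_mono (ρ := Real.sqrt 2 - 1) bx bx0 k_bd (by rw [abs_le]; constructor <;> linarith)
    mAC mBC mAD mBD mCD cn
  rw [div_mul_cancel₀ _ (Real.sqrt_pos.2 (Gd_box bx0)).ne', sub_self, sub_nonneg] at m
  rw [div_le_iff₀ (Real.sqrt_pos.2 (Gd_box bx))]
  exact m
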